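/- For every X ∈ {O, SO, R, E} and every quantifier Q ∈ {∀, ∃}, the 3CMs form a countable, effectively encodable family, and there is no algorithm (computable function on codes of 3CMs) that, given a 3CM M, decides whether R_M ∈ CT^X_Q; i.e., chase termination for each of the oblivious, semi-oblivious, restricted, and equivalent (core) chase variants is undecidable within the concrete class C = {R_M : M a 3CM}. -/

import Mathlib

set_option maxHeartbeats 1000000
set_option synthInstance.maxHeartbeats 1000000
set_option synthInstance.maxSize 512

attribute [local instance] Classical.propDecidable

noncomputable section

/-! ### Terms and atoms -/

/-- Variables: ordinary variables `Sum.inl n`, or fresh variables `Sum.inr (c, k)`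
introduced by the trigger with code `c` for the head variable with code `k`. -/
abbrev Var : Type := ℕ ⊕ (ℕ × ℕ)

/-- Terms: constants `Sum.inl c` or variables `Sum.inr v`. -/
abbrev FTerm : Type := ℕ ⊕ Var

def ct (n : ℕ) : FTerm := Sum.inl n
def vt (n : ℕ) : FTerm := Sum.inr (Sum.inl n)

/-- An atom: a predicate name together with its list of arguments. -/
abbrev Atom : Type := ℕ × List FTerm

/-- Active domain: all terms occurring in an atom set. -/
def adom (J : Set Atom) : Set FTerm := {t | ∃ a ∈ J, t ∈ a.2}

def atomVarsF (a : Atom) : Finset Var := (a.2.filterMap Sum.getRight?).toFinset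

def varsF (A : Finset Atom) : Finset Var := A.biUnion atomVarsF

def setVars (J : Set Atom) : Set Var := {v | ∃ a ∈ J, Sum.inr v ∈ a.2}

/-! ### Substitutions and homomorphisms -/

abbrev Subst := Var → FTerm

def applyT (σ : Subst) : FTerm → FTerm
  | Sum.inl c => Sum.inl c
  | Sum.inr v => σ v

def applyA (σ : Subst) (a : Atom) : Atom := (a.1, a.2.map (applyT σ))

def IsHomOn (σ : Subst) (A B : Set Atom) : Prop := ∀ a ∈ A, applyA σ a ∈ B

def HomBetween (A B : Set Atom) : Prop := ∃ σ : Subst, IsHomOn σ A B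

def IsRetraction (σ : Subst) (A B : Set Atom) : Prop :=
  IsHomOn σ A B ∧ ∀ v ∈ setVars A ∩ setVars B, σ v = Sum.inr v

/-- Isomorphism of atom sets: a pair of mutually inverse homomorphisms. -/
def Isomorphic (A B : Set Atom) : Prop :=
  ∃ σ τ : Subst, IsHomOn σ A B ∧ IsHomOn τ B A ∧
    (∀ a ∈ A, applyA τ (applyA σ a) = a) ∧ (∀ b ∈ B, applyA σ (applyA τ b) = b)

/-! ### Rules -/

/-- A rule is a pair (body, head). Its existential variables are the head variables
not occurring in the body; its frontier the variables shared by body and head.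
A rule is Datalog when every head variable occurs in the body. -/
abbrev Rule : Type := Finset Atom × Finset Atom

def frontierOf (R : Rule) : Finset Var := varsF R.1 ∩ varsF R.2

def DatRules (Rset : Finset Rule) : Finset Rule := Rset.filter fun R => varsF R.2 ⊆ varsF R.1
def NDatRules (Rset : Finset Rule) : Finset Rule := Rset.filter fun R => ¬ varsF R.2 ⊆ varsF R.1

/-- Satisfaction of a rule in an atom set. -/
def SatisfiesRule (J : Set Atom) (R : Rule) : Prop :=
  ∀ σ : Subst, IsHomOn σ (R.1 : Set Atom) J →
    ∃ σ' : Subst, (∀ v ∈ varsF R.1, σ' v = σ v) ∧ IsHomOn σ' (R.2 : Set Atom) J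

def IsModel (Rset : Finset Rule) (I J : Set Atom) : Prop :=
  (∀ R ∈ Rset, SatisfiesRule J R) ∧ HomBetween I J

/-- BCQ entailment: every model of the KB satisfies the query. -/
def Entails (Rset : Finset Rule) (I q : Set Atom) : Prop :=
  ∀ J : Set Atom, IsModel Rset I J → HomBetween q J

def IsUniversalModel (Rset : Finset Rule) (I U : Set Atom) : Prop :=
  IsModel Rset I U ∧ ∀ J : Set Atom, IsModel Rset I J → HomBetween U J

/-! ### Triggers -/

structure Trigger where
  rule : Rule
  sub : Subst

/-- Injective code of a trigger (a trigger is determined by its rule and the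
restriction of its substitution to the body variables). -/
def Trigger.code (t : Trigger) : ℕ :=
  Encodable.encode (t.rule, (varsF t.rule.1).image fun v => (v, t.sub v))

/-- The canonical extension of the trigger substitution, mapping each existential
variable `z` to the fresh variable unique for `z` and the trigger. -/
def Trigger.extSub (t : Trigger) : Subst := fun v =>
  if v ∈ varsF t.rule.1 then t.sub v
  else Sum.inr (Sum.inr (t.code, Encodable.encode v))

def Trigger.out (t : Trigger) : Finset Atom := t.rule.2.image (applyA t.extSub)

def Trigger.isOn (t : Trigger) (J : Set Atom) : Prop := IsHomOn t.sub (t.rule.1 : Set Atom) J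

/-! ### Chase variants, derivations, chase termination classes -/

inductive ChaseVariant : Type
  | O | SO | R | E
deriving DecidableEq

def Applicable : ChaseVariant → Trigger → Set Atom → Prop
  | .O, t, J => ¬ ((t.out : Set Atom) ⊆ J)
  | .SO, t, J => ∀ t' : Trigger, t'.rule = t.rule → t'.isOn J →
      (∀ v ∈ frontierOf t.rule, t'.sub v = t.sub v) → ¬ ((t'.out : Set Atom) ⊆ J)
  | .R, t, J => ¬ ∃ σ : Subst, IsRetraction σ (J ∪ (t.out : Set Atom)) J
  | .E, t, J => ¬ ∃ σ : Subst, IsHomOn σ (J ∪ (t.out : Set Atom)) J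

def instSeq (I : Set Atom) (steps : ℕ → Option Trigger) : ℕ → Set Atom
  | 0 => I
  | n + 1 => instSeq I steps n ∪
      (match steps n with
        | none => (∅ : Set Atom)
        | some t => (t.out : Set Atom))

/-- A (possibly infinite) derivation from the knowledge base `⟨Rset, I⟩`. -/
structure Deriv (Rset : Finset Rule) (I : Set Atom) where
  steps : ℕ → Option Trigger
  prefix_closed : ∀ n, steps n = none → steps (n + 1) = none
  valid : ∀ n t, steps n = some t →
    t.rule ∈ Rset ∧ t.isOn (instSeq I steps n) ∧ ¬ ((t.out : Set Atom) ⊆ instSeq I steps n)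

def Deriv.inst {Rset : Finset Rule} {I : Set Atom} (D : Deriv Rset I) (n : ℕ) :
    Set Atom := instSeq I D.steps n

def Deriv.res {Rset : Finset Rule} {I : Set Atom} (D : Deriv Rset I) : Set Atom :=
  ⋃ n, D.inst n

def Deriv.Finite {Rset : Finset Rule} {I : Set Atom} (D : Deriv Rset I) : Prop :=
  ∃ n, D.steps n = none

def Deriv.IsX {Rset : Finset Rule} {I : Set Atom} (X : ChaseVariant)
    (D : Deriv Rset I) : Prop :=
  ∀ n t, D.steps n = some t → Applicable X t (D.inst n)

def Deriv.Fair {Rset : Finset Rule} {I : Set Atom} (X : ChaseVariant)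
    (D : Deriv Rset I) : Prop :=
  ∀ i, ∀ t : Trigger, t.rule ∈ Rset → t.isOn (D.inst i) → Applicable X t (D.inst i) →
    ∃ j, i < j ∧ ¬ Applicable X t (D.inst j)

/-- All-instance, all-derivation chase termination. -/
def CTall (X : ChaseVariant) (Rset : Finset Rule) : Prop :=
  ∀ I : Finset Atom, ∀ D : Deriv Rset (I : Set Atom), D.IsX X → D.Fair X → D.Finite

/-- All-instance, some-derivation chase termination. -/
def CTex (X : ChaseVariant) (Rset : Finset Rule) : Prop :=
  ∀ I : Finset Atom, ∃ D : Deriv Rset (I : Set Atom), D.IsX X ∧ D.Fair X ∧ D.Finite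

inductive CTQuant : Type
  | all | ex

def CT (X : ChaseVariant) : CTQuant → Finset Rule → Prop
  | .all => CTall X
  | .ex => CTex X

/-- The result of some fair `X`-derivation from `⟨Rset, J⟩`. -/
def ChX (X : ChaseVariant) (Rset : Finset Rule) (J : Set Atom) : Set Atom :=
  if h : ∃ D : Deriv Rset J, D.IsX X ∧ D.Fair X then h.choose.res else J

/-! ### Gaifman graph, treewidth, bts -/

def gaifmanAdj (J : Set Atom) (u v : FTerm) : Prop :=
  u ≠ v ∧ ∃ a ∈ J, u ∈ a.2 ∧ v ∈ a.2

/-- The (Gaifman graph of the) atom set `J` has treewidth at most `k`: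
there is a tree decomposition all of whose bags have size at most `k + 1`. -/
def TreewidthAtMost (J : Set Atom) (k : ℕ) : Prop :=
  ∃ (ι : Type) (T : SimpleGraph ι) (bag : ι → Finset FTerm),
    T.Connected ∧ T.IsAcyclic ∧
    (∀ v ∈ adom J, ∃ i, v ∈ bag i) ∧
    (∀ u v : FTerm, gaifmanAdj J u v → ∃ i, u ∈ bag i ∧ v ∈ bag i) ∧
    (∀ v : FTerm, (SimpleGraph.induce {i | v ∈ bag i} T).Preconnected) ∧
    (∀ i, (bag i).card ≤ k + 1)

/-- Bounded-treewidth sets: for every instance, some universal model of bounded treewidth. -/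
def IsBts (Rset : Finset Rule) : Prop :=
  ∀ I : Finset Atom, ∃ (k : ℕ) (U : Set Atom),
    IsUniversalModel Rset (I : Set Atom) U ∧ TreewidthAtMost U k

/-! ### Three-counter machines -/

/-- A three-counter machine: states `0, …, m − 1` (state `0` is initial, standing for `q₁`),
and a partial transition function given by a finite table. -/
structure TCM where
  m : ℕ
  hm : 0 < m
  δ : List ((ℕ × Bool × Bool) × (ℕ × Int × Int))
  keys_nodup : (δ.map Prod.fst).Nodup
  wf : ∀ e ∈ δ, e.1.1 < m ∧ e.2.1 < m ∧ e.2.2.1.natAbs ≤ 1 ∧ e.2.2.2.natAbs ≤ 1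

/-- A configuration: state, two counters, and the time counter. -/
abbrev Config : Type := ℕ × ℕ × ℕ × ℕ

def TCM.step (M : TCM) (q : ℕ) (b1 b2 : Bool) : Option (ℕ × Int × Int) :=
  (M.δ.find? fun e => decide (e.1 = (q, b1, b2))).map Prod.snd

def TCM.next (M : TCM) (C : Config) : Option Config :=
  match M.step C.1 (decide (C.2.1 ≠ 0)) (decide (C.2.2.1 ≠ 0)) with
  | none => none
  | some (q', d1, d2) =>
      some (q', ((C.2.1 : ℤ) + d1).toNat, ((C.2.2.1 : ℤ) + d2).toNat, C.2.2.2 + 1)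

def TCM.run (M : TCM) : ℕ → Option Config
  | 0 => some (0, 0, 0, 0)
  | n + 1 => (M.run n).bind M.next

/-- The machine halts: some reachable configuration has no successor. -/
def TCM.Halts (M : TCM) : Prop := ∃ n C, M.run n = some C ∧ M.next C = none

/-! ### Prime encoding of configurations -/

/-- The least prime strictly greater than `n` (computably). -/
def nextPrime (n : ℕ) : ℕ := Nat.find (Nat.exists_infinite_primes (n + 1))

/-- `prm i` is the `(i+1)`-st prime `p_{i+1}`, i.e. `prm 0 = 2`. -/
def prm : ℕ → ℕ
  | 0 => 2
  | k + 1 => nextPrime (prm k)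

/-- Encoding of a configuration as a natural number. -/
def TCM.enc (M : TCM) (C : Config) : ℕ :=
  prm C.1 * prm M.m ^ C.2.1 * prm (M.m + 1) ^ C.2.2.1 * prm (M.m + 2) ^ C.2.2.2

/-- `p = p₁ ⋯ p_{m+3}`. -/
def TCM.p (M : TCM) : ℕ := ∏ i ∈ Finset.range (M.m + 3), prm i

/-- Decode the state from a residue modulo `M.p`. -/
def TCM.stateOf (M : TCM) (i : ℕ) : Option ℕ :=
  (List.range M.m).find? fun s => decide (prm s ∣ i)

/-- The canonical pair `(q_i, r_i)` realizing the prime encoding of the transitions. -/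
def TCM.qr (M : TCM) (i : ℕ) : ℕ × ℕ :=
  match M.stateOf i with
  | none => (1, 1)
  | some s =>
      let b1 : Bool := decide (prm M.m ∣ i)
      let b2 : Bool := decide (prm (M.m + 1) ∣ i)
      match M.step s b1 b2 with
      | none => (1, 1)
      | some (s', d1, d2) =>
          let e1 : ℤ := if b1 then d1 else max d1 0
          let e2 : ℤ := if b2 then d2 else max d2 0
          let num : ℕ := prm s' * prm (M.m + 2) *
            (if e1 = 1 then prm M.m else 1) * (if e2 = 1 then prm (M.m + 1) else 1)
          let den : ℕ := prm s *
            (if e1 = -1 then prm M.m else 1) * (if e2 = -1 then prm (M.m + 1) else 1)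
          (num / Nat.gcd num den, den / Nat.gcd num den)

def TCM.qi (M : TCM) (i : ℕ) : ℕ := (M.qr i).1
def TCM.ri (M : TCM) (i : ℕ) : ℕ := (M.qr i).2

/-- `g(n) = q_{n mod p} · n / r_{n mod p}`. -/
def TCM.g (M : TCM) (n : ℕ) : ℕ := M.qi (n % M.p) * n / M.ri (n % M.p)

/-- `gᵏ(2)`. -/
def TCM.gIter (M : TCM) (k : ℕ) : ℕ := (M.g)^[k] 2

/-- `G = {gᵏ(2) : k ∈ ℕ}`. -/
def TCM.Gset (M : TCM) : Set ℕ := Set.range M.gIter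

/-! ### The rule set `R_M` -/

def pEnd : ℕ := 0
def pFlood : ℕ := 1
def pS0 : ℕ := 2
def pS : ℕ := 3
def pG : ℕ := 4
def pR (i : ℕ) : ℕ := 5 + 2 * i
def pT (i : ℕ) : ℕ := 6 + 2 * i

/-- `j`-th vertex of an `S`-path of length `n` from variable `a` to variable `b`
with fresh intermediate variables `base + 1, …, base + n − 1`. -/
def pathVar (a b base n j : ℕ) : FTerm :=
  if j = 0 then vt a else if j = n then vt b else vt (base + j)

/-- The atoms of `Sⁿ(x_a, x_b)`: an `S`-path of length `n`. -/
def spath (a b base n : ℕ) : Finset Atom :=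
  (Finset.range n).image fun j =>
    (pS, [pathVar a b base n j, pathVar a b base n (j + 1)])

/-- Rule (1): `S₀(x,y) → S(x,y)`. -/
def ruleS : Rule := ({(pS0, [vt 0, vt 1])}, {(pS, [vt 0, vt 1])})

/-- Rule (2): `R_i(x,y) ∧ S(y,z) → R_{i+1}(x,z)` (indices modulo `p`). -/
def ruleR (M : TCM) (i : ℕ) : Rule :=
  ({(pR i, [vt 0, vt 1]), (pS, [vt 1, vt 2])}, {(pR ((i + 1) % M.p), [vt 0, vt 2])})

/-- Rule (3): `T_i(x,y,z) ∧ S^{r_i}(y,y′) ∧ S^{q_i}(z,z′) → T_i(x,y′,z′)`. -/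
def ruleT (M : TCM) (i : ℕ) : Rule :=
  (({(pT i, [vt 0, vt 1, vt 2])} : Finset Atom) ∪ spath 1 3 10 (M.ri i) ∪
      spath 2 4 (11 + M.ri i) (M.qi i),
    {(pT i, [vt 0, vt 3, vt 4])})

/-- Rule (4): `S(x,y) → Flood(y)`. -/
def ruleFloodProp : Rule := ({(pS, [vt 0, vt 1])}, {(pFlood, [vt 1])})

/-- Rule (5): `End(x) → S(x,x)`. -/
def ruleSEnd : Rule := ({(pEnd, [vt 0])}, {(pS, [vt 0, vt 0])})

/-- Rule (6): `S²(x,y) → G(x,y)`. -/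
def ruleGInit : Rule := (spath 0 1 10 2, {(pG, [vt 0, vt 1])})

/-- Rule (7): `G(x,y) ∧ R_i(x,y) ∧ T_i(x,y,z) → G(x,z)`. -/
def ruleGStep (i : ℕ) : Rule :=
  ({(pG, [vt 0, vt 1]), (pR i, [vt 0, vt 1]), (pT i, [vt 0, vt 1, vt 2])},
    {(pG, [vt 0, vt 2])})

/-- Rule (8): `Flood(x) ∧ Flood(y) ∧ Flood(z) → G(x,y) ∧ ⋀_{j<p} (R_j(x,y) ∧ T_j(x,y,z))`. -/
def ruleFloodGen (M : TCM) : Rule :=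
  ({(pFlood, [vt 0]), (pFlood, [vt 1]), (pFlood, [vt 2])},
    ({(pG, [vt 0, vt 1])} : Finset Atom) ∪
      (Finset.range M.p).biUnion fun j =>
        {(pR j, [vt 0, vt 1]), (pT j, [vt 0, vt 1, vt 2])})

/-- Rule (9): `G(y,z) ∧ End(z) → ∃x (S₀(x,y) ∧ R₀(x,x) ∧ ⋀_{j<p} T_j(x,x,x))`. -/
def ruleEx (M : TCM) : Rule :=
  ({(pG, [vt 1, vt 2]), (pEnd, [vt 2])},
    ({(pS0, [vt 0, vt 1]), (pR 0, [vt 0, vt 0])} : Finset Atom) ∪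
      (Finset.range M.p).biUnion fun j => {(pT j, [vt 0, vt 0, vt 0])})

/-- The rule set `R_M`. -/
def RM (M : TCM) : Finset Rule :=
  ({ruleS, ruleFloodProp, ruleSEnd, ruleGInit, ruleFloodGen M, ruleEx M} : Finset Rule) ∪
    (Finset.range M.p).biUnion fun i => {ruleR M i, ruleT M i, ruleGStep i}

/-- The alternating Datalog/non-Datalog chase steps `Step^X_n`. -/
def StepX (X : ChaseVariant) (M : TCM) : ℕ → Set Atom → Set Atom
  | 0, I => ChX X (DatRules (RM M)) I
  | n + 1, I => ChX X (DatRules (RM M)) (ChX X (NDatRules (RM M)) (StepX X M n I))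

/-- The constant `w`, the "well of positivity". -/
def wC : FTerm := ct 0

/-- The instance `{End(w)}`. -/
def IE : Set Atom := {(pEnd, [wC])}

/-- Membership in the signature of `R_M` (predicate together with its arity). -/
def InSig (M : TCM) (a : Atom) : Prop :=
  ((a.1 = pEnd ∨ a.1 = pFlood) ∧ a.2.length = 1) ∨
  ((a.1 = pS0 ∨ a.1 = pS ∨ a.1 = pG ∨ ∃ i < M.p, a.1 = pR i) ∧ a.2.length = 2) ∨
  ((∃ i < M.p, a.1 = pT i) ∧ a.2.length = 3)

/-- The critical instance: all atoms `P(w, …, w)` over the signature of `R_M`. -/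
def Crit (M : TCM) : Set Atom := {a | InSig M a ∧ ∀ t ∈ a.2, t = wC}

/-- An `S`-path of length `k` from `s` to `t` in `J`. -/
def SPath (J : Set Atom) : ℕ → FTerm → FTerm → Prop
  | 0, s, t => s = t
  | k + 1, s, t => ∃ u, (pS, [s, u]) ∈ J ∧ SPath J k u t

/-- The restriction `J|_S`: atoms of `J` all of whose terms belong to `S`. -/
def restrictTo (J : Set Atom) (S : Set FTerm) : Set Atom := {a ∈ J | ∀ t ∈ a.2, t ∈ S}

/-- An explicit injective encoding of three-counter machines by natural numbers. -/
def encodeTCM (M : TCM) : ℕ := Encodable.encode (M.m, M.δ)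

open Encodable

/-! ### Encodings grow -/

theorem encode_list_mem {α} [Encodable α] (l : List α) (a : α) (h : a ∈ l) :
    encode a < encode l := by
  induction l with
  | nil => simp at h
  | cons b l ih =>
    rw [Encodable.encode_list_cons]
    rcases List.mem_cons.1 h with rfl | h
    · exact Nat.lt_succ_of_le (Nat.left_le_pair _ _)
    · exact lt_of_lt_of_le (ih h) (le_trans (Nat.right_le_pair _ _) (Nat.le_succ _))

theorem encode_finset_mem {α} [Encodable α] (s : Finset α) (a : α) (h : a ∈ s) :
    encode a < encode s := by
  show encode a < encodeMultiset s.1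
  unfold encodeMultiset
  apply encode_list_mem
  rw [← Multiset.mem_coe, Multiset.sort_eq]
  exact h

/-! ### General facts on derivations -/

theorem instSeq_mono_succ (I : Set Atom) (s : ℕ → Option Trigger) (n : ℕ) :
    instSeq I s n ⊆ instSeq I s (n + 1) := Set.subset_union_left

theorem instSeq_mono (I : Set Atom) (s : ℕ → Option Trigger) : Monotone (instSeq I s) :=
  monotone_nat_of_le_succ (instSeq_mono_succ I s)

theorem instSeq_out (I : Set Atom) (s : ℕ → Option Trigger) (n : ℕ) (t : Trigger)
    (h : s n = some t) : (t.out : Set Atom) ⊆ instSeq I s (n + 1) := by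
  simp only [instSeq, h]
  exact Set.subset_union_right

theorem isOn_mono {t : Trigger} {J K : Set Atom} (h : J ⊆ K) (ht : t.isOn J) : t.isOn K :=
  fun a ha => h (ht a ha)

theorem applyT_id (x : FTerm) : applyT (fun v => Sum.inr v) x = x := by
  cases x <;> rfl

theorem applyA_id (a : Atom) : applyA (fun v => Sum.inr v) a = a := by
  have : applyT (fun v => Sum.inr v) = id := funext applyT_id
  simp [applyA, this]

theorem applicable_out {X : ChaseVariant} {t : Trigger} {J : Set Atom}
    (h : Applicable X t J) (ht : t.isOn J) : ¬ ((t.out : Set Atom) ⊆ J) := by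
  intro hs
  have hu : J ∪ (t.out : Set Atom) = J := Set.union_eq_left.2 hs
  cases X with
  | O => exact h hs
  | SO => exact h t rfl ht (fun _ _ => rfl) hs
  | R =>
    refine h ⟨fun v => Sum.inr v, ?_, fun _ _ => rfl⟩
    rw [hu]
    intro a ha
    rwa [applyA_id]
  | E =>
    refine h ⟨fun v => Sum.inr v, ?_⟩
    rw [hu]
    intro a ha
    rwa [applyA_id]

theorem code_inj {t t' : Trigger} (h : t.code = t'.code) :
    t.rule = t'.rule ∧ ∀ v ∈ varsF t.rule.1, t.sub v = t'.sub v := by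
  have h := Encodable.encode_injective h
  rw [Prod.mk.injEq] at h
  refine ⟨h.1, fun v hv => ?_⟩
  have hm : (v, t.sub v) ∈ (varsF t.rule.1).image fun v => (v, t.sub v) :=
    Finset.mem_image_of_mem (fun v => (v, t.sub v)) hv
  rw [h.2] at hm
  obtain ⟨w, _, hw⟩ := Finset.mem_image.1 hm
  rw [Prod.mk.injEq] at hw
  obtain ⟨rfl, hw⟩ := hw
  exact hw.symm

theorem code_out {t t' : Trigger} (h : t.code = t'.code) : t.out = t'.out := by
  obtain ⟨h1, h2⟩ := code_inj h
  have : t.extSub = t'.extSub := by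
    funext v
    unfold Trigger.extSub
    rw [h, ← h1]
    split_ifs with hv
    · exact h2 v hv
    · rfl
  unfold Trigger.out
  rw [this, h1]

/-! ### Greedy fair derivations -/

def Cand (Rset : Finset Rule) (X : ChaseVariant) (J : Set Atom) (t : Trigger) : Prop :=
  t.rule ∈ Rset ∧ t.isOn J ∧ Applicable X t J

theorem exists_pick (Rset : Finset Rule) (X : ChaseVariant) (J : Set Atom) :
    ∃ o : Option Trigger, (o = none → ∀ t, ¬ Cand Rset X J t) ∧
      ∀ t, o = some t → Cand Rset X J t ∧ ∀ t', Cand Rset X J t' → t.code ≤ t'.code := by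
  by_cases h : ∃ t, Cand Rset X J t
  · have h' : ∃ n, ∃ t, Cand Rset X J t ∧ t.code = n := ⟨_, h.choose, h.choose_spec, rfl⟩
    obtain ⟨t, ht, hc⟩ := Nat.find_spec h'
    refine ⟨some t, by simp, ?_⟩
    rintro _ ⟨⟩
    refine ⟨ht, fun t' ht' => ?_⟩
    rw [hc]
    exact Nat.find_min' h' ⟨t', ht', rfl⟩
  · exact ⟨none, fun _ t ht => h ⟨t, ht⟩, by simp⟩

def pick (Rset : Finset Rule) (X : ChaseVariant) (J : Set Atom) : Option Trigger :=
  (exists_pick Rset X J).choose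

def greedyInst (Rset : Finset Rule) (X : ChaseVariant) (I : Set Atom) : ℕ → Set Atom
  | 0 => I
  | n + 1 => greedyInst Rset X I n ∪
      (match pick Rset X (greedyInst Rset X I n) with
        | none => (∅ : Set Atom)
        | some t => (t.out : Set Atom))

def greedySteps (Rset : Finset Rule) (X : ChaseVariant) (I : Set Atom) (n : ℕ) :
    Option Trigger := pick Rset X (greedyInst Rset X I n)

theorem greedy_inst (Rset : Finset Rule) (X : ChaseVariant) (I : Set Atom) (n : ℕ) :
    instSeq I (greedySteps Rset X I) n = greedyInst Rset X I n := by
  induction n with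
  | zero => rfl
  | succ n ih =>
    simp only [instSeq, greedyInst, ih]
    rfl

theorem exists_fair (Rset : Finset Rule) (X : ChaseVariant) (I : Set Atom) :
    ∃ D : Deriv Rset I, D.IsX X ∧ D.Fair X := by
  have hp : ∀ n t, greedySteps Rset X I n = some t →
      Cand Rset X (instSeq I (greedySteps Rset X I) n) t ∧
      ∀ t', Cand Rset X (instSeq I (greedySteps Rset X I) n) t' → t.code ≤ t'.code := by
    intro n t h
    rw [greedy_inst]
    exact (exists_pick Rset X (greedyInst Rset X I n)).choose_spec.2 t h
  have hn : ∀ n, greedySteps Rset X I n = none →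
      ∀ t, ¬ Cand Rset X (instSeq I (greedySteps Rset X I) n) t := by
    intro n h
    rw [greedy_inst]
    exact (exists_pick Rset X (greedyInst Rset X I n)).choose_spec.1 h
  refine ⟨⟨greedySteps Rset X I, ?_, ?_⟩, ?_, ?_⟩
  · intro n h
    have : greedyInst Rset X I (n + 1) = greedyInst Rset X I n := by
      have h' : pick Rset X (greedyInst Rset X I n) = none := h
      simp [greedyInst, h']
    unfold greedySteps at h ⊢
    rw [this, h]
  · intro n t h
    obtain ⟨⟨h1, h2, h3⟩, _⟩ := hp n t h
    exact ⟨h1, h2, applicable_out h3 h2⟩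
  · intro n t h
    exact (hp n t h).1.2.2
  · intro i t hr ht _
    by_contra hcon
    push Not at hcon
    have hc : ∀ j, i < j → Cand Rset X (instSeq I (greedySteps Rset X I) j) t := fun j hj =>
      ⟨hr, isOn_mono (instSeq_mono _ _ hj.le) ht, hcon j hj⟩
    have hs : ∀ j, ∃ s, greedySteps Rset X I (i + 1 + j) = some s := by
      intro j
      cases h : greedySteps Rset X I (i + 1 + j) with
      | none => exact absurd (hc _ (by omega)) (hn _ h t)
      | some s => exact ⟨s, rfl⟩
    choose s hs using hs
    have hlt : ∀ j k, j < k → (s j).code ≠ (s k).code := by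
      intro j k hjk he
      have hk := hp _ _ (hs k)
      refine applicable_out hk.1.2.2 hk.1.2.1 ?_
      rw [← code_out he]
      exact (instSeq_out I _ _ _ (hs j)).trans (instSeq_mono _ _ (by omega))
    have hinj : Function.Injective fun j => (s j).code := by
      intro j k he
      rcases lt_trichotomy j k with h | h | h
      · exact absurd he (hlt _ _ h)
      · exact h
      · exact absurd he.symm (hlt _ _ h)
    refine Set.infinite_range_of_injective hinj ((Set.finite_Iic t.code).subset ?_)
    rintro _ ⟨j, rfl⟩
    exact (hp _ _ (hs j)).2 t (hc _ (by omega))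

/-- If all derivations are finite then both termination notions hold. -/
theorem CT_of_all_finite (Rset : Finset Rule)
    (h : ∀ I : Finset Atom, ∀ D : Deriv Rset (I : Set Atom), D.Finite)
    (X : ChaseVariant) (Q : CTQuant) : CT X Q Rset := by
  cases Q with
  | all => exact fun I D _ _ => h I D
  | ex =>
    intro I
    obtain ⟨D, h1, h2⟩ := exists_fair Rset X (I : Set Atom)
    exact ⟨D, h1, h2, h I D⟩

/-- If all fair derivations from some instance are infinite then both notions fail. -/
theorem not_CT_of_all_infinite (Rset : Finset Rule) (X : ChaseVariant) (I : Finset Atom)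
    (h : ∀ D : Deriv Rset (I : Set Atom), D.Fair X → ¬ D.Finite)
    (Q : CTQuant) : ¬ CT X Q Rset := by
  cases Q with
  | all =>
    intro hc
    obtain ⟨D, h1, h2⟩ := exists_fair Rset X (I : Set Atom)
    exact h D h2 (hc I D h1 h2)
  | ex =>
    intro hc
    obtain ⟨D, _, h2, h3⟩ := hc I
    exact h D h2 h3

/-- A derivation all of whose instances stay in a finite set is finite. -/
theorem finite_of_bounded {Rset : Finset Rule} {I : Set Atom} (D : Deriv Rset I)
    (U : Set Atom) (hU : U.Finite) (h : ∀ n, D.inst n ⊆ U) : D.Finite := by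
  by_contra hcon
  have hs : ∀ n, ∃ t, D.steps n = some t := by
    intro n
    cases h : D.steps n with
    | none => exact absurd ⟨n, h⟩ hcon
    | some s => exact ⟨s, rfl⟩
  have hlt : StrictMono D.inst := by
    refine strictMono_nat_of_lt_succ fun n => ?_
    obtain ⟨t, ht⟩ := hs n
    refine ssubset_of_subset_not_subset (instSeq_mono_succ _ _ n) fun hsub => ?_
    exact (D.valid n t ht).2.2 ((instSeq_out _ _ _ _ ht).trans hsub)
  have := Set.infinite_range_of_injective hlt.injective
  exact this (hU.finite_subsets.subset (by rintro _ ⟨n, rfl⟩; exact h n))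

open Encodable

/-! ### Fresh nulls of the existential rule -/

theorem mem_varsF {A : Finset Atom} {a : Atom} {n : ℕ} (ha : a ∈ A) (h : vt n ∈ a.2) :
    (Sum.inl n : Var) ∈ varsF A := by
  unfold varsF atomVarsF
  rw [Finset.mem_biUnion]
  refine ⟨a, ha, ?_⟩
  rw [List.mem_toFinset, List.mem_filterMap]
  exact ⟨_, h, rfl⟩

theorem extSub_of_mem {t : Trigger} {n : ℕ} {a : Atom} (ha : a ∈ t.rule.1) (h : vt n ∈ a.2) :
    applyT t.extSub (vt n) = t.sub (Sum.inl n) := by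
  simp [applyT, vt, Trigger.extSub, mem_varsF ha h]

def nul (M : TCM) (y z : FTerm) : FTerm :=
  Sum.inr (Sum.inr (encode ((ruleEx M : Rule),
    ({((Sum.inl 1 : Var), y), ((Sum.inl 2 : Var), z)} : Finset (Var × FTerm))),
    encode (Sum.inl 0 : Var)))

theorem varsF_ruleEx (M : TCM) : varsF (ruleEx M).1 = {Sum.inl 1, Sum.inl 2} := by
  ext v
  simp [varsF, atomVarsF, ruleEx, vt]

theorem extSub_ruleEx (M : TCM) (t : Trigger) (h : t.rule = ruleEx M) :
    applyT t.extSub (vt 0) = nul M (t.sub (Sum.inl 1)) (t.sub (Sum.inl 2)) := by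
  have h0 : (Sum.inl 0 : Var) ∉ varsF t.rule.1 := by
    rw [h, varsF_ruleEx]
    simp
  simp only [applyT, vt, Trigger.extSub, h0, if_false, nul, Trigger.code]
  rw [h, varsF_ruleEx]
  congr 5

theorem le_encode_fst (a b : ℕ) : a ≤ encode (a, b) := by
  rw [encode_prod_val]
  exact Nat.left_le_pair a b

theorem encode_lt_nul (M : TCM) (y z : FTerm) : encode y < encode (nul M y z) := by
  have h1 : encode ((Sum.inl 1 : Var), y) <
      encode ({((Sum.inl 1 : Var), y), ((Sum.inl 2 : Var), z)} : Finset (Var × FTerm)) :=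
    encode_finset_mem _ _ (by simp)
  have h2 : encode y ≤ encode ((Sum.inl 1 : Var), y) := Nat.right_le_pair _ _
  have h3 : encode ({((Sum.inl 1 : Var), y), ((Sum.inl 2 : Var), z)} : Finset (Var × FTerm)) ≤
      encode ((ruleEx M : Rule),
        ({((Sum.inl 1 : Var), y), ((Sum.inl 2 : Var), z)} : Finset (Var × FTerm))) :=
    Nat.right_le_pair _ _
  have h4 : encode ((ruleEx M : Rule),
        ({((Sum.inl 1 : Var), y), ((Sum.inl 2 : Var), z)} : Finset (Var × FTerm))) ≤
      encode (encode ((ruleEx M : Rule),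
        ({((Sum.inl 1 : Var), y), ((Sum.inl 2 : Var), z)} : Finset (Var × FTerm))),
        encode (Sum.inl 0 : Var)) := le_encode_fst _ _
  unfold nul
  rw [encode_inr, encode_inr]
  omega

theorem nul_inj {M : TCM} {y z y' z' : FTerm} (h : nul M y z = nul M y' z') : y = y' := by
  unfold nul at h
  rw [Sum.inr.injEq, Sum.inr.injEq, Prod.mk.injEq] at h
  have h := Encodable.encode_injective h.1
  rw [Prod.mk.injEq] at h
  have hm : ((Sum.inl 1 : Var), y) ∈
    ({((Sum.inl 1 : Var), y'), ((Sum.inl 2 : Var), z')} : Finset (Var × FTerm)) := by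
    rw [← h.2]
    simp
  simpa using hm

/-! ### Levels, edges, walks -/

def Lv (M : TCM) (L : ℕ) : ℕ → Set FTerm
  | 0 => {t | encode t ≤ L}
  | k + 1 => Lv M L k ∪ Set.image2 (nul M) (Lv M L k) {t | encode t ≤ L}

theorem Lv_finite (M : TCM) (L k : ℕ) : (Lv M L k).Finite := by
  have h0 : (Lv M L 0).Finite :=
    Set.Finite.preimage (Encodable.encode_injective.injOn) (Set.finite_Iic L)
  induction k with
  | zero => exact h0
  | succ k ih => exact ih.union (ih.image2 _ h0)

theorem Lv_mono (M : TCM) (L : ℕ) : Monotone (Lv M L) :=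
  monotone_nat_of_le_succ fun _ => Set.subset_union_left

def Ed (M : TCM) (L : ℕ) (x y : FTerm) : Prop :=
  (x ∈ Lv M L 0 → y ∈ Lv M L 0) ∧ (x ∉ Lv M L 0 → ∃ z ∈ Lv M L 0, x = nul M y z)

def Walk (M : TCM) (L : ℕ) : ℕ → FTerm → FTerm → Prop
  | 0, x, y => x = y
  | n + 1, x, y => ∃ u, Ed M L x u ∧ Walk M L n u y

theorem Walk.append {M : TCM} {L n m : ℕ} {x y z : FTerm} (h : Walk M L n x y)
    (h' : Walk M L m y z) : Walk M L (n + m) x z := by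
  induction n generalizing x with
  | zero => cases h; simpa using h'
  | succ n ih =>
    obtain ⟨u, hu, h⟩ := h
    rw [Nat.succ_add]
    exact ⟨u, hu, ih h⟩

theorem Ed.walk {M : TCM} {L : ℕ} {x y : FTerm} (h : Ed M L x y) : Walk M L 1 x y := ⟨y, h, rfl⟩

theorem Walk.not_mem {M : TCM} {L n j : ℕ} {x y : FTerm} (h : Walk M L j x y) (hj : j ≤ n)
    (hx : x ∉ Lv M L n) : y ∉ Lv M L (n - j) := by
  induction j generalizing x n with
  | zero => cases h; simpa using hx
  | succ j ih =>
    obtain ⟨u, hu, h⟩ := h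
    obtain ⟨n, rfl⟩ : ∃ k, n = k + 1 := ⟨n - 1, by omega⟩
    have hx0 : x ∉ Lv M L 0 := fun h0 => hx (Lv_mono M L (Nat.zero_le _) h0)
    obtain ⟨z, hz, rfl⟩ := hu.2 hx0
    have hu' : u ∉ Lv M L n := fun h0 => hx (Or.inr ⟨u, h0, z, hz, rfl⟩)
    have := ih h (by omega : j ≤ n) hu'
    rwa [Nat.add_sub_add_right]

theorem Walk.mem_zero {M : TCM} {L j : ℕ} {x y : FTerm} (h : Walk M L j x y)
    (hx : x ∈ Lv M L 0) : y ∈ Lv M L 0 := by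
  induction j generalizing x with
  | zero => cases h; exact hx
  | succ j ih =>
    obtain ⟨u, hu, h⟩ := h
    exact ih h (hu.1 hx)

theorem Walk.encode_le {M : TCM} {L j : ℕ} {x y : FTerm} (h : Walk M L j x y)
    (hy : y ∉ Lv M L 0) : encode y + j ≤ encode x := by
  induction j generalizing x with
  | zero => cases h; simp
  | succ j ih =>
    have hx : x ∉ Lv M L 0 := fun h0 => hy (h.mem_zero h0)
    obtain ⟨u, hu, h⟩ := h
    obtain ⟨z, hz, rfl⟩ := hu.2 hx
    have := encode_lt_nul M u z
    have := ih h
    omega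

theorem Walk.unique {M : TCM} {L j k : ℕ} {x y : FTerm} (h : Walk M L j x y)
    (h' : Walk M L k x y) (hy : y ∉ Lv M L 0) : j = k := by
  induction j generalizing x k with
  | zero =>
    cases h
    have := h'.encode_le hy
    omega
  | succ j ih =>
    cases k with
    | zero =>
      cases h'
      have := h.encode_le hy
      omega
    | succ k =>
      have hx : x ∉ Lv M L 0 := fun h0 => hy (h.mem_zero h0)
      obtain ⟨u, hu, h⟩ := h
      obtain ⟨u', hu', h'⟩ := h'
      obtain ⟨z, hz, rfl⟩ := hu.2 hx
      obtain ⟨z', hz', he⟩ := hu'.2 hx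
      cases nul_inj he
      rw [ih h h']

/-! ### The invariant -/

structure Good (M : TCM) (L B : ℕ) (I : Set Atom) (a : Atom) : Prop where
  gEnd : ∀ z, a = (pEnd, [z]) → z ∈ Lv M L 0
  gS0 : ∀ x y, a = (pS0, [x, y]) → Ed M L x y ∧ y ∈ Lv M L (B + 1)
  gS : ∀ x y, a = (pS, [x, y]) → Ed M L x y ∧ y ∈ Lv M L (B + 1)
  gFlood : ∀ x, a = (pFlood, [x]) → x ∈ Lv M L (B + 1)
  gG : ∀ x y, a = (pG, [x, y]) → x ∉ Lv M L (B + 1) → ∃ d ∈ M.Gset, Walk M L d x y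
  gR : ∀ i x y, a = (pR i, [x, y]) → x ∉ Lv M L (B + 1) → ∃ d, d % M.p = i ∧ Walk M L d x y
  gT : ∀ i x y z, a = (pT i, [x, y, z]) → x ∉ Lv M L (B + 1) →
    ∃ k, Walk M L (M.ri i * k) x y ∧ Walk M L (M.qi i * k) x z
  gDom : ∀ t ∈ a.2, t ∈ Lv M L (B + 2)
  gSig : a ∈ I ∨ (a.1 ≤ 6 + 2 * M.p ∧ a.2.length ≤ 3)

section
variable {M : TCM} {L B : ℕ} {I : Set Atom}

theorem Good.mkS0 {x y : FTerm} (h : Ed M L x y) (hy : y ∈ Lv M L (B + 1))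
    (hx : x ∈ Lv M L (B + 2)) : Good M L B I (pS0, [x, y]) := by
  have hy' := Lv_mono M L (by omega : B + 1 ≤ B + 2) hy
  constructor <;> simp [pEnd, pS0, pS, pFlood, pG, pR, pT, *] <;> intros <;> omega

theorem Good.mkS {x y : FTerm} (h : Ed M L x y) (hy : y ∈ Lv M L (B + 1))
    (hx : x ∈ Lv M L (B + 2)) : Good M L B I (pS, [x, y]) := by
  have hy' := Lv_mono M L (by omega : B + 1 ≤ B + 2) hy
  constructor <;> simp [pEnd, pS0, pS, pFlood, pG, pR, pT, *] <;> intros <;> omega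

theorem Good.mkFlood {x : FTerm} (hx : x ∈ Lv M L (B + 1)) : Good M L B I (pFlood, [x]) := by
  have hy' := Lv_mono M L (by omega : B + 1 ≤ B + 2) hx
  constructor <;> simp [pEnd, pS0, pS, pFlood, pG, pR, pT, *] <;> intros <;> omega

theorem Good.mkG {x y : FTerm} (hx : x ∈ Lv M L (B + 2)) (hy : y ∈ Lv M L (B + 2))
    (h : x ∉ Lv M L (B + 1) → ∃ d ∈ M.Gset, Walk M L d x y) : Good M L B I (pG, [x, y]) := by
  constructor
  case gG => simpa using h
  all_goals simp [pEnd, pS0, pS, pFlood, pG, pR, pT, *] <;> intros <;> omega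

theorem Good.mkR {i : ℕ} {x y : FTerm} (hi : i < M.p) (hx : x ∈ Lv M L (B + 2))
    (hy : y ∈ Lv M L (B + 2))
    (h : x ∉ Lv M L (B + 1) → ∃ d, d % M.p = i ∧ Walk M L d x y) :
    Good M L B I (pR i, [x, y]) := by
  constructor
  case gR =>
    intro i' x' y' he
    simp [pR] at he
    obtain ⟨rfl, rfl, rfl⟩ := he
    exact h
  all_goals simp [pEnd, pS0, pS, pFlood, pG, pR, pT, *] <;> intros <;> omega

theorem Good.mkT {i : ℕ} {x y z : FTerm} (hi : i < M.p) (hx : x ∈ Lv M L (B + 2))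
    (hy : y ∈ Lv M L (B + 2)) (hz : z ∈ Lv M L (B + 2))
    (h : x ∉ Lv M L (B + 1) →
      ∃ k, Walk M L (M.ri i * k) x y ∧ Walk M L (M.qi i * k) x z) :
    Good M L B I (pT i, [x, y, z]) := by
  constructor
  case gT =>
    intro i' x' y' z' he
    simp [pT] at he
    obtain ⟨rfl, rfl, rfl, rfl⟩ := he
    exact h
  all_goals simp [pEnd, pS0, pS, pFlood, pG, pR, pT, *] <;> intros <;> omega

theorem spath_walk {J : Set Atom} (hJ : ∀ a ∈ J, Good M L B I a) {σ : Subst} {a b base n : ℕ}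
    (hn : 0 < n) (h : ∀ c ∈ spath a b base n, applyA σ c ∈ J) :
    Walk M L n (σ (Sum.inl a)) (σ (Sum.inl b)) := by
  have key : ∀ j ≤ n, Walk M L j (applyT σ (pathVar a b base n 0))
      (applyT σ (pathVar a b base n j)) := by
    intro j
    induction j with
    | zero => intro _; rfl
    | succ j ih =>
      intro hj
      refine (ih (by omega)).append (Ed.walk ?_)
      have := h (pS, [pathVar a b base n j, pathVar a b base n (j + 1)])
        (Finset.mem_image.2 ⟨j, Finset.mem_range.2 (by omega), rfl⟩)
      exact ((hJ _ this).gS _ _ rfl).1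
  have := key n le_rfl
  simpa [pathVar, hn.ne', applyT, vt] using this

theorem spath_mem_right {a b base n : ℕ} (hn : 0 < n) :
    ∃ c ∈ spath a b base n, vt b ∈ c.2 := by
  refine ⟨_, Finset.mem_image.2 ⟨n - 1, Finset.mem_range.2 (by omega), rfl⟩, ?_⟩
  have : n - 1 + 1 = n := by omega
  simp [pathVar, this, hn.ne']

theorem spath_mem_left {a b base n : ℕ} (hn : 0 < n) :
    ∃ c ∈ spath a b base n, vt a ∈ c.2 := by
  refine ⟨_, Finset.mem_image.2 ⟨0, Finset.mem_range.2 (by omega), rfl⟩, ?_⟩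
  simp [pathVar]

theorem p_pos (M : TCM) (hp : 0 < M.p) (n : ℕ) : n % M.p < M.p := Nat.mod_lt _ hp

theorem step_good (hB : ∀ d ∈ M.Gset, d ≤ B) (hr : ∀ i, 0 < M.ri i) (hq : ∀ i, 0 < M.qi i)
    {J : Set Atom} (hJ : ∀ a ∈ J, Good M L B I a) (t : Trigger) (ht : t.rule ∈ RM M)
    (hon : t.isOn J) : ∀ a ∈ t.out, Good M L B I a := by
  intro a ha
  obtain ⟨c, hc, rfl⟩ := Finset.mem_image.1 ha
  have hdom : ∀ b ∈ t.rule.1, ∀ n, vt n ∈ b.2 → t.sub (Sum.inl n) ∈ Lv M L (B + 2) := by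
    intro b hb n hn
    refine (hJ _ (hon b hb)).gDom _ ?_
    exact List.mem_map.2 ⟨vt n, hn, rfl⟩
  have hsub : ∀ b ∈ t.rule.1, ∀ n, vt n ∈ b.2 →
      applyT t.extSub (vt n) = t.sub (Sum.inl n) := fun b hb n hn => extSub_of_mem hb hn
  have hex := extSub_ruleEx M t
  obtain ⟨rule, σ⟩ := t
  generalize Trigger.extSub ⟨rule, σ⟩ = τ at *
  simp only [Trigger.isOn, IsHomOn, Finset.mem_coe] at *
  simp only [RM, Finset.mem_union, Finset.mem_insert, Finset.mem_singleton,
    Finset.mem_biUnion, Finset.mem_range] at ht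
  rcases ht with (rfl | rfl | rfl | rfl | rfl | rfl) | ⟨i, hi, rfl | rfl | rfl⟩
  · -- S
    simp only [ruleS, Finset.mem_singleton, forall_eq] at hc hon hdom hsub
    subst hc
    have h := (hJ _ hon).gS0 _ _ rfl
    simp only [applyA, List.map, hsub 0 (by simp), hsub 1 (by simp)]
    exact Good.mkS h.1 h.2 (hdom 0 (by simp))
  · -- FloodProp
    simp only [ruleFloodProp, Finset.mem_singleton, forall_eq] at hc hon hdom hsub
    subst hc
    have h := (hJ _ hon).gS _ _ rfl
    simp only [applyA, List.map, hsub 1 (by simp)]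
    exact Good.mkFlood h.2
  · -- SEnd
    simp only [ruleSEnd, Finset.mem_singleton, forall_eq] at hc hon hdom hsub
    subst hc
    have h := (hJ _ hon).gEnd _ rfl
    simp only [applyA, List.map, hsub 0 (by simp)]
    exact Good.mkS ⟨fun _ => h, fun h' => absurd h h'⟩ (Lv_mono M L (Nat.zero_le _) h)
      (Lv_mono M L (Nat.zero_le _) h)
  · -- GInit
    simp only [ruleGInit, Finset.mem_singleton] at hc hon hdom hsub
    subst hc
    obtain ⟨b0, hb0, h0⟩ := spath_mem_left (a := 0) (b := 1) (base := 10) (n := 2) (by omega)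
    obtain ⟨b1, hb1, h1⟩ := spath_mem_right (a := 0) (b := 1) (base := 10) (n := 2) (by omega)
    simp only [applyA, List.map, hsub b0 hb0 0 h0, hsub b1 hb1 1 h1]
    exact Good.mkG (hdom b0 hb0 0 h0) (hdom b1 hb1 1 h1) fun _ =>
      ⟨2, ⟨0, rfl⟩, spath_walk hJ (by omega) hon⟩
  · -- FloodGen
    simp only [ruleFloodGen, Finset.mem_union, Finset.mem_singleton, Finset.mem_biUnion,
      Finset.mem_range, Finset.mem_insert, forall_eq_or_imp, forall_eq] at hc hon hdom hsub
    have hx : σ (Sum.inl 0) ∈ Lv M L (B + 1) := (hJ _ hon.1).gFlood _ rfl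
    have h0 := hdom.1 0 (by simp)
    have h1 := hdom.2.1 1 (by simp)
    have h2 := hdom.2.2 2 (by simp)
    have e0 := hsub.1 0 (by simp)
    have e1 := hsub.2.1 1 (by simp)
    have e2 := hsub.2.2 2 (by simp)
    rcases hc with rfl | ⟨j, hj, rfl | rfl⟩
    · simp only [applyA, List.map, e0, e1]
      exact Good.mkG h0 h1 fun h => absurd hx h
    · simp only [applyA, List.map, e0, e1]
      exact Good.mkR hj h0 h1 fun h => absurd hx h
    · simp only [applyA, List.map, e0, e1, e2]
      exact Good.mkT hj h0 h1 h2 fun h => absurd hx h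
  · -- Ex
    have hex := hex rfl
    simp only [ruleEx, Finset.mem_union, Finset.mem_singleton, Finset.mem_biUnion,
      Finset.mem_range, Finset.mem_insert, forall_eq_or_imp, forall_eq] at hc hon hdom hsub
    have hz : σ (Sum.inl 2) ∈ Lv M L 0 := (hJ _ hon.2).gEnd _ rfl
    have hy : σ (Sum.inl 1) ∈ Lv M L (B + 1) := by
      by_contra hy
      obtain ⟨d, hd, hw⟩ := (hJ _ hon.1).gG _ _ rfl hy
      have := hB d hd
      exact hw.not_mem (by omega) hy (Lv_mono M L (Nat.zero_le _) hz)
    have hx : nul M (σ (Sum.inl 1)) (σ (Sum.inl 2)) ∈ Lv M L (B + 2) :=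
      Or.inr ⟨_, hy, _, hz, rfl⟩
    have hp : 0 < M.p ∨ M.p = 0 := by omega
    have e1 := hsub.1 1 (by simp)
    rcases hc with (rfl | rfl) | ⟨j, hj, rfl | rfl⟩
    · simp only [applyA, List.map, hex, e1]
      refine Good.mkS0 ⟨fun h => ?_, fun _ => ⟨_, hz, rfl⟩⟩ hy hx
      exact le_trans (encode_lt_nul M _ _).le h
    · simp only [applyA, List.map, hex]
      rcases hp with hp | hp
      · exact Good.mkR hp hx hx fun _ => ⟨0, by simp, rfl⟩
      · exact absurd hp (by
          have := hr 0
          intro h0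
          have hpos : 0 < M.p := by
            refine Finset.prod_pos fun i _ => ?_
            cases i with
            | zero => simp [prm]
            | succ k =>
              have := (Nat.find_spec (Nat.exists_infinite_primes (prm k + 1))).2
              exact this.pos
          omega)
    · simp only [applyA, List.map, hex]
      exact Good.mkT hj hx hx hx fun _ => ⟨0, by rw [Nat.mul_zero]; exact ⟨rfl, rfl⟩⟩
  · -- R
    simp only [ruleR, Finset.mem_singleton, Finset.mem_insert, forall_eq_or_imp,
      forall_eq] at hc hon hdom hsub
    subst hc
    simp only [applyA, List.map, hsub.1 0 (by simp), hsub.2 2 (by simp)]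
    refine Good.mkR (Nat.mod_lt _ (by omega)) (hdom.1 0 (by simp)) (hdom.2 2 (by simp))
      fun hx => ?_
    obtain ⟨d, hd, hw⟩ := (hJ _ hon.1).gR _ _ _ rfl hx
    have he := ((hJ _ hon.2).gS _ _ rfl).1
    refine ⟨d + 1, ?_, hw.append he.walk⟩
    rw [← hd]
    simp
  · -- T
    simp only [ruleT, Finset.mem_singleton, Finset.mem_union] at hc hon hdom hsub
    subst hc
    obtain ⟨b3, hb3, h3⟩ := spath_mem_right (a := 1) (b := 3) (base := 10) (hr i)
    obtain ⟨b4, hb4, h4⟩ := spath_mem_right (a := 2) (b := 4) (base := 11 + M.ri i) (hq i)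
    simp only [applyA, List.map, hsub _ (Or.inl (Or.inl rfl)) 0 (by simp),
      hsub b3 (Or.inl (Or.inr hb3)) 3 h3, hsub b4 (Or.inr hb4) 4 h4]
    refine Good.mkT hi (hdom _ (Or.inl (Or.inl rfl)) 0 (by simp))
      (hdom b3 (Or.inl (Or.inr hb3)) 3 h3) (hdom b4 (Or.inr hb4) 4 h4) fun hx => ?_
    obtain ⟨k, hk1, hk2⟩ := (hJ _ (hon _ (Or.inl (Or.inl rfl)))).gT _ _ _ _ rfl hx
    refine ⟨k + 1, ?_, ?_⟩
    · rw [Nat.mul_succ]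
      exact hk1.append (spath_walk hJ (hr i) fun c hc => hon c (Or.inl (Or.inr hc)))
    · rw [Nat.mul_succ]
      exact hk2.append (spath_walk hJ (hq i) fun c hc => hon c (Or.inr hc))
  · -- GStep
    simp only [ruleGStep, Finset.mem_singleton, Finset.mem_insert, forall_eq_or_imp,
      forall_eq] at hc hon hdom hsub
    subst hc
    simp only [applyA, List.map, hsub.1 0 (by simp), hsub.2.2 2 (by simp)]
    refine Good.mkG (hdom.1 0 (by simp)) (hdom.2.2 2 (by simp)) fun hx => ?_
    obtain ⟨d, hd, hw⟩ := (hJ _ hon.1).gG _ _ rfl hx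
    obtain ⟨d', hd', hw'⟩ := (hJ _ hon.2.1).gR _ _ _ rfl hx
    obtain ⟨k, hk1, hk2⟩ := (hJ _ hon.2.2).gT _ _ _ _ rfl hx
    have hy := hw.not_mem (by have := hB d hd; omega) hx
    have hy0 : σ (Sum.inl 1) ∉ Lv M L 0 := fun h => hy (Lv_mono M L (Nat.zero_le _) h)
    have e1 := hw.unique hw' hy0
    have e2 := hw.unique hk1 hy0
    subst e1
    refine ⟨M.g d, ?_, ?_⟩
    · obtain ⟨n, rfl⟩ := hd
      exact ⟨n + 1, Function.iterate_succ_apply' _ _ _⟩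
    · have : M.g d = M.qi i * k := by
        unfold TCM.g
        rw [hd']
        conv_lhs => rw [e2]
        rw [show M.qi i * (M.ri i * k) = M.ri i * (M.qi i * k) by ring]
        exact Nat.mul_div_cancel_left _ (hr i)
      rw [this]
      exact hk2

end

theorem atoms_finite (S : Set FTerm) (hS : S.Finite) (n m : ℕ) :
    {a : Atom | (∀ t ∈ a.2, t ∈ S) ∧ a.1 ≤ n ∧ a.2.length ≤ m}.Finite := by
  have : Finite S := hS
  have h := (List.finite_length_le S m).image (List.map Subtype.val)
  refine ((Set.finite_Iic n).prod h).subset ?_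
  rintro ⟨P, l⟩ ⟨h1, h2, h3⟩
  refine ⟨h2, l.attach.map fun t => ⟨t.1, h1 _ t.2⟩, by simpa using h3, ?_⟩
  rw [List.map_map]
  exact List.attach_map_subtype_val l

theorem all_finite_of_bounded (M : TCM) (B : ℕ) (hB : ∀ d ∈ M.Gset, d ≤ B)
    (hr : ∀ i, 0 < M.ri i) (hq : ∀ i, 0 < M.qi i) (I : Finset Atom)
    (D : Deriv (RM M) (I : Set Atom)) : D.Finite := by
  obtain ⟨L, hL⟩ : ∃ L, ∀ a ∈ I, ∀ t ∈ a.2, encode t ≤ L := by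
    refine ⟨∑ a ∈ I, encode a.2, fun a ha t ht => ?_⟩
    refine (encode_list_mem _ _ ht).le.trans ?_
    exact Finset.single_le_sum (f := fun a : Atom => encode a.2) (fun _ _ => Nat.zero_le _) ha
  have hg : ∀ n, ∀ a ∈ D.inst n, Good M L B (I : Set Atom) a := by
    intro n
    induction n with
    | zero =>
      intro a ha
      have hd : ∀ t ∈ a.2, t ∈ Lv M L 0 := hL a ha
      have hd' : ∀ k, ∀ t ∈ a.2, t ∈ Lv M L k := fun k t h =>
        Lv_mono M L (Nat.zero_le _) (hd t h)
      constructor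
      · rintro z rfl; exact hd _ (by simp)
      · rintro x y rfl
        exact ⟨⟨fun _ => hd _ (by simp), fun h => absurd (hd _ (by simp)) h⟩, hd' _ _ (by simp)⟩
      · rintro x y rfl
        exact ⟨⟨fun _ => hd _ (by simp), fun h => absurd (hd _ (by simp)) h⟩, hd' _ _ (by simp)⟩
      · rintro z rfl; exact hd' _ _ (by simp)
      · rintro x y rfl h; exact absurd (hd' _ _ (by simp)) h
      · rintro i x y rfl h; exact absurd (hd' _ _ (by simp)) h
      · rintro i x y z rfl h; exact absurd (hd' _ _ (by simp)) h
      · exact hd' _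
      · exact Or.inl ha
    | succ n ih =>
      intro a ha
      rcases ha with ha | ha
      · exact ih a ha
      · cases hs : D.steps n with
        | none => simp [hs] at ha
        | some t =>
          simp only [hs] at ha
          obtain ⟨h1, h2, _⟩ := D.valid n t hs
          exact step_good hB hr hq ih t h1 h2 a ha
  refine finite_of_bounded D ((I : Set Atom) ∪ _)
    (I.finite_toSet.union (atoms_finite _ (Lv_finite M L (B + 2)) (6 + 2 * M.p) 3)) ?_
  intro n a ha
  have h := hg n a ha
  rcases h.gSig with hI | hs
  · exact Or.inl hI
  · exact Or.inr ⟨h.gDom, hs.1, hs.2⟩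

open Encodable

/-! ### Extracting a finite model from a finite fair derivation -/

def compS (σ τ : Subst) : Subst := fun v => applyT σ (τ v)

theorem applyT_compS (σ τ : Subst) (x : FTerm) :
    applyT (compS σ τ) x = applyT σ (applyT τ x) := by
  cases x <;> rfl

theorem applyA_compS (σ τ : Subst) (a : Atom) :
    applyA (compS σ τ) a = applyA σ (applyA τ a) := by
  simp [applyA, applyT_compS]

def powS (α : Subst) : ℕ → Subst
  | 0 => fun v => Sum.inr v
  | n + 1 => compS (powS α n) α

theorem applyA_powS (α : Subst) (n : ℕ) (a : Atom) :
    applyA (powS α n) a = (applyA α)^[n] a := by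
  induction n generalizing a with
  | zero => exact applyA_id a
  | succ n ih => rw [powS, applyA_compS, ih, Function.iterate_succ_apply]

theorem mem_varsF_gen {A : Finset Atom} {a : Atom} {v : Var} :
    v ∈ varsF A ↔ ∃ a ∈ A, (Sum.inr v : FTerm) ∈ a.2 := by
  unfold varsF atomVarsF
  rw [Finset.mem_biUnion]
  refine exists_congr fun a => and_congr_right fun _ => ?_
  rw [List.mem_toFinset, List.mem_filterMap]
  constructor
  · rintro ⟨t, ht, h⟩
    cases t with
    | inl c => simp at h
    | inr w =>
      simp at h
      subst h
      exact ht
  · intro h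
    exact ⟨_, h, rfl⟩

theorem applyA_congr {σ τ : Subst} {a : Atom}
    (h : ∀ v, (Sum.inr v : FTerm) ∈ a.2 → σ v = τ v) : applyA σ a = applyA τ a := by
  unfold applyA
  congr 1
  refine List.map_congr_left fun x hx => ?_
  cases x with
  | inl c => rfl
  | inr v => exact h v hx

theorem applyT_eq_of_applyA_eq {σ : Subst} {a : Atom} (h : applyA σ a = a) {x : FTerm}
    (hx : x ∈ a.2) : applyT σ x = x := by
  have h2 : a.2.map (applyT σ) = a.2 := congrArg Prod.snd h
  have h3 : a.2.map (applyT σ) = a.2.map id := by rw [h2, List.map_id]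
  exact List.map_inj_left.1 h3 x hx

theorem model_of_SO {J : Set Atom} {R : Rule}
    (h : ∀ t : Trigger, t.rule = R → t.isOn J → ¬ Applicable .SO t J) : SatisfiesRule J R := by
  intro σ hσ
  have h1 := h ⟨R, σ⟩ rfl hσ
  simp only [Applicable] at h1
  push Not at h1
  obtain ⟨t', hr, hon, hfr, hout⟩ := h1
  refine ⟨fun v => if v ∈ varsF R.1 then σ v else t'.extSub v, fun v hv => by simp [hv], ?_⟩
  intro a ha
  have : applyA (fun v => if v ∈ varsF R.1 then σ v else t'.extSub v) a
      = applyA t'.extSub a := by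
    refine applyA_congr fun v hv => ?_
    by_cases hv1 : v ∈ varsF R.1
    · simp only [hv1, if_true]
      have : v ∈ varsF R.2 := (mem_varsF_gen (a := a)).2 ⟨a, ha, hv⟩
      rw [← hfr v (Finset.mem_inter.2 ⟨hv1, this⟩)]
      simp only [Trigger.extSub, hr, hv1, if_true]
    · simp only [hv1, if_false]
  rw [this]
  apply hout
  rw [Finset.mem_coe, Trigger.out, hr]
  exact Finset.mem_image_of_mem _ ha

theorem exists_core {J : Set Atom} (hJ : J.Finite) (Rset : Finset Rule)
    (h : ∀ t : Trigger, t.rule ∈ Rset → t.isOn J → ¬ Applicable .E t J) :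
    ∃ C ⊆ J, (∀ R ∈ Rset, SatisfiesRule C R) ∧ ∃ σ : Subst, ∀ a ∈ J, applyA σ a ∈ C := by
  have hex : ∃ n, ∃ σ : Subst, IsHomOn σ J J ∧ (applyA σ '' J).ncard = n :=
    ⟨_, fun v => Sum.inr v, fun a ha => by rwa [applyA_id], rfl⟩
  obtain ⟨σ, hσ, hcard⟩ := Nat.find_spec hex
  have hmin : ∀ τ : Subst, IsHomOn τ J J → (applyA σ '' J).ncard ≤ (applyA τ '' J).ncard := by
    intro τ hτ
    rw [hcard]
    exact Nat.find_min' hex ⟨τ, hτ, rfl⟩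
  set C := applyA σ '' J with hC
  have hCJ : C ⊆ J := by
    rintro _ ⟨a, ha, rfl⟩
    exact hσ a ha
  have hCf : C.Finite := hJ.subset hCJ
  refine ⟨C, hCJ, ?_, σ, fun a ha => ⟨a, ha, rfl⟩⟩
  intro R hR π hπ
  have h1 := h ⟨R, π⟩ hR (fun a ha => hCJ (hπ a ha))
  simp only [Applicable, not_not] at h1
  obtain ⟨k, hk⟩ := h1
  set α := compS σ k with hα
  have hαC : ∀ a ∈ J ∪ ((Trigger.mk R π).out : Set Atom), applyA α a ∈ C := by
    intro a ha
    rw [hα, applyA_compS]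
    exact ⟨_, hk a ha, rfl⟩
  have hαCC : Set.MapsTo (applyA α) C C := fun a ha => hαC a (Or.inl (hCJ ha))
  have himg : applyA α '' C = C := by
    have hm := hmin (compS α σ) (fun a ha => by
      rw [applyA_compS]
      exact hCJ (hαCC ⟨a, ha, rfl⟩))
    have he : applyA (compS α σ) '' J = applyA α '' C := by
      rw [hC, Set.image_image]
      exact Set.image_congr fun a _ => applyA_compS _ _ _
    rw [he] at hm
    exact Set.eq_of_subset_of_ncard_le hαCC.image_subset hm hCf
  have : Finite C := hCf
  have hsurj : Function.Surjective (hαCC.restrict (applyA α) C C) := by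
    rw [Set.MapsTo.restrict_surjective_iff]
    exact himg.ge
  have hbij : Function.Bijective (hαCC.restrict (applyA α) C C) :=
    ⟨Finite.injective_iff_surjective.2 hsurj, hsurj⟩
  obtain ⟨m, hm, hpow⟩ := isOfFinOrder_iff_pow_eq_one.1
    (isOfFinOrder_of_finite (Equiv.ofBijective _ hbij))
  have hfix : ∀ a ∈ C, (applyA α)^[m] a = a := by
    intro a ha
    have h2 := congrArg (fun e : Equiv.Perm C => (e ⟨a, ha⟩ : C)) hpow
    have h3 : ∀ n (x : C), (((Equiv.ofBijective _ hbij : Equiv.Perm C) ^ n) x : C).1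
        = (applyA α)^[n] x.1 := by
      intro n
      induction n with
      | zero => intro x; rfl
      | succ n ih =>
        intro x
        rw [pow_succ, Equiv.Perm.mul_apply, ih, Function.iterate_succ_apply]
        rfl
    have h4 := h3 m ⟨a, ha⟩
    rw [← h4]
    exact congrArg Subtype.val h2
  refine ⟨compS (powS α m) (Trigger.mk R π).extSub, ?_, ?_⟩
  · intro v hv
    obtain ⟨a, ha, hva⟩ := (mem_varsF_gen (a := (0, []))).1 hv
    have h5 : applyA (powS α m) (applyA π a) = applyA π a := by
      rw [applyA_powS]
      exact hfix _ (hπ a ha)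
    have h6 := applyT_eq_of_applyA_eq h5 (x := π v) (List.mem_map.2 ⟨_, hva, rfl⟩)
    simp only [compS, Trigger.extSub, hv, if_true]
    exact h6
  · intro a ha
    rw [applyA_compS, applyA_powS]
    obtain ⟨m, rfl⟩ : ∃ k, m = k + 1 := ⟨m - 1, by omega⟩
    rw [Function.iterate_succ_apply]
    refine Set.MapsTo.iterate hαCC m (hαC _ (Or.inr ?_))
    exact Finset.mem_coe.2 (Finset.mem_image_of_mem _ ha)

theorem inst_finite {Rset : Finset Rule} {I : Set Atom} (hI : I.Finite) (D : Deriv Rset I)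
    (n : ℕ) : (D.inst n).Finite := by
  induction n with
  | zero => exact hI
  | succ n ih =>
    refine Set.Finite.union ih ?_
    cases D.steps n with
    | none => exact Set.finite_empty
    | some t => exact t.out.finite_toSet

theorem exists_model {Rset : Finset Rule} {I : Set Atom} (hI : I.Finite) (X : ChaseVariant)
    (D : Deriv Rset I) (hF : D.Fair X) (hfin : D.Finite) :
    ∃ N, ∃ C ⊆ D.inst N, (∀ R ∈ Rset, SatisfiesRule C R) ∧
      ∃ σ : Subst, ∀ a ∈ D.inst N, applyA σ a ∈ C := by
  obtain ⟨N, hN⟩ := hfin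
  have hnone : ∀ k, D.steps (N + k) = none := by
    intro k
    induction k with
    | zero => exact hN
    | succ k ih => exact D.prefix_closed _ ih
  have hconst : ∀ k, D.inst (N + k) = D.inst N := by
    intro k
    induction k with
    | zero => rfl
    | succ k ih =>
      rw [← ih]
      show instSeq I D.steps (N + k + 1) = _
      simp only [instSeq, hnone k, Set.union_empty]
      rfl
  have happ : ∀ t : Trigger, t.rule ∈ Rset → t.isOn (D.inst N) →
      ¬ Applicable X t (D.inst N) := by
    intro t h1 h2 h3
    obtain ⟨j, hj, h4⟩ := hF N t h1 h2 h3
    obtain ⟨k, rfl⟩ := Nat.exists_eq_add_of_le hj.le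
    rw [hconst] at h4
    exact h4 h3
  refine ⟨N, ?_⟩
  have hSO : (∀ t : Trigger, t.rule ∈ Rset → t.isOn (D.inst N) →
      ¬ Applicable .SO t (D.inst N)) → ∃ C ⊆ D.inst N, (∀ R ∈ Rset, SatisfiesRule C R) ∧
      ∃ σ : Subst, ∀ a ∈ D.inst N, applyA σ a ∈ C := by
    intro h
    refine ⟨D.inst N, subset_rfl, fun R hR => ?_, fun v => Sum.inr v, fun a ha => by
      rwa [applyA_id]⟩
    refine model_of_SO fun t ht hon => h t (ht ▸ hR) hon
  cases X with
  | O =>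
    refine hSO fun t h1 h2 h3 => happ t h1 h2 fun h4 => ?_
    exact h3 t rfl h2 (fun _ _ => rfl) h4
  | SO => exact hSO happ
  | R =>
    refine exists_core (inst_finite hI D N) Rset fun t h1 h2 h3 => happ t h1 h2 fun h4 => ?_
    obtain ⟨σ, hσ⟩ := h4
    exact h3 ⟨σ, hσ.1⟩
  | E => exact exists_core (inst_finite hI D N) Rset happ

/-! ### Chains in models -/

theorem sat_datalog {C : Set Atom} {R : Rule} (h : SatisfiesRule C R) (σ : Subst)
    (hb : ∀ a ∈ R.1, applyA σ a ∈ C) {a : Atom} (ha : a ∈ R.2)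
    (hv : ∀ v, (Sum.inr v : FTerm) ∈ a.2 → v ∈ varsF R.1) : applyA σ a ∈ C := by
  obtain ⟨σ', h1, h2⟩ := h σ hb
  rw [← applyA_congr (σ := σ') fun v hva => h1 v (hv v hva)]
  exact h2 a ha

def sb (f : ℕ → FTerm) : Subst := fun v => match v with
  | Sum.inl n => f n
  | Sum.inr _ => wC

theorem applyT_sb (f : ℕ → FTerm) (n : ℕ) : applyT (sb f) (vt n) = f n := rfl

theorem sat_datalog' {C : Set Atom} {R : Rule} (h : SatisfiesRule C R) (f : ℕ → FTerm)
    (hb : ∀ a ∈ R.1, applyA (sb f) a ∈ C) {P : ℕ} {l : List ℕ} (ha : (P, l.map vt) ∈ R.2)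
    (hv : ∀ n ∈ l, ∃ b ∈ R.1, vt n ∈ b.2) : (P, l.map f) ∈ C := by
  have := sat_datalog h (sb f) hb ha (by
    intro v hva
    obtain ⟨n, hn, hnv⟩ := List.mem_map.1 hva
    obtain rfl : Sum.inl n = v := Sum.inr.inj hnv
    obtain ⟨b, hb, hnb⟩ := hv n hn
    exact mem_varsF hb hnb)
  rw [applyA] at this
  rw [List.map_map] at this
  exact this

section
variable {M : TCM} {C : Set Atom}

theorem cloS (hC : ∀ R ∈ RM M, SatisfiesRule C R) {x y : FTerm} (h : (pS0, [x, y]) ∈ C) : (pS, [x, y]) ∈ C := by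
  refine sat_datalog' (l := [0, 1]) (hC ruleS (by simp [RM]))
    (fun n => if n = 0 then x else y) ?_ ?_ ?_
  · simpa [ruleS, applyA, applyT_sb] using h
  · simp [ruleS]
  · simp [ruleS]

theorem cloFlood (hC : ∀ R ∈ RM M, SatisfiesRule C R) {x y : FTerm} (h : (pS, [x, y]) ∈ C) : (pFlood, [y]) ∈ C := by
  refine sat_datalog' (l := [1]) (hC ruleFloodProp (by simp [RM]))
    (fun n => if n = 0 then x else y) ?_ ?_ ?_
  · simpa [ruleFloodProp, applyA, applyT_sb] using h
  · simp [ruleFloodProp]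
  · simp [ruleFloodProp]

theorem cloSEnd (hC : ∀ R ∈ RM M, SatisfiesRule C R) {x : FTerm} (h : (pEnd, [x]) ∈ C) : (pS, [x, x]) ∈ C := by
  refine sat_datalog' (l := [0, 0]) (hC ruleSEnd (by simp [RM]))
    (fun n => x) ?_ ?_ ?_
  · simpa [ruleSEnd, applyA, applyT_sb] using h
  · simp [ruleSEnd]
  · simp [ruleSEnd]

theorem cloR (hC : ∀ R ∈ RM M, SatisfiesRule C R) {i : ℕ} (hi : i < M.p) {x y z : FTerm} (h : (pR i, [x, y]) ∈ C)
    (h' : (pS, [y, z]) ∈ C) : (pR ((i + 1) % M.p), [x, z]) ∈ C := by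
  refine sat_datalog' (l := [0, 2]) (hC (ruleR M i) ?_)
    (fun n => if n = 0 then x else if n = 1 then y else z) ?_ ?_ ?_
  · simp only [RM, Finset.mem_union, Finset.mem_biUnion, Finset.mem_range]
    exact Or.inr ⟨i, hi, by simp⟩
  · simp [ruleR, applyA, applyT_sb, h, h']
  · simp [ruleR]
  · simp [ruleR]

theorem cloGStep (hC : ∀ R ∈ RM M, SatisfiesRule C R) {i : ℕ} (hi : i < M.p) {x y z : FTerm} (h : (pG, [x, y]) ∈ C)
    (h' : (pR i, [x, y]) ∈ C) (h'' : (pT i, [x, y, z]) ∈ C) : (pG, [x, z]) ∈ C := by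
  refine sat_datalog' (l := [0, 2]) (hC (ruleGStep i) ?_)
    (fun n => if n = 0 then x else if n = 1 then y else z) ?_ ?_ ?_
  · simp only [RM, Finset.mem_union, Finset.mem_biUnion, Finset.mem_range]
    exact Or.inr ⟨i, hi, by simp⟩
  · simp [ruleGStep, applyA, applyT_sb, h, h', h'']
  · simp [ruleGStep]
  · simp [ruleGStep]

theorem cloGInit (hC : ∀ R ∈ RM M, SatisfiesRule C R) {x y z : FTerm} (h : (pS, [x, y]) ∈ C) (h' : (pS, [y, z]) ∈ C) :
    (pG, [x, z]) ∈ C := by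
  refine sat_datalog' (l := [0, 1]) (hC ruleGInit (by simp [RM]))
    (fun n => if n = 0 then x else if n = 1 then z else y) ?_ ?_ ?_
  · intro a ha
    simp only [ruleGInit, spath, Finset.mem_image, Finset.mem_range] at ha
    obtain ⟨j, hj, rfl⟩ := ha
    interval_cases j
    · simpa [applyA, applyT_sb, pathVar] using h
    · simpa [applyA, applyT_sb, pathVar] using h'
  · simp [ruleGInit]
  · intro n hn
    simp at hn
    rcases hn with rfl | rfl
    · exact spath_mem_left (by omega)
    · exact spath_mem_right (by omega)

theorem cloFloodG (hC : ∀ R ∈ RM M, SatisfiesRule C R) {x : FTerm} (h : (pFlood, [x]) ∈ C) : (pG, [x, x]) ∈ C := by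
  refine sat_datalog' (l := [0, 1]) (hC (ruleFloodGen M) (by simp [RM]))
    (fun n => x) ?_ ?_ ?_
  · simpa [ruleFloodGen, applyA, applyT_sb] using h
  · simp [ruleFloodGen]
  · simp [ruleFloodGen]

theorem cloT (hC : ∀ R ∈ RM M, SatisfiesRule C R) (hr : ∀ i, 0 < M.ri i) (hq : ∀ i, 0 < M.qi i) {i : ℕ} (hi : i < M.p)
    {x : FTerm} {u v : ℕ → FTerm} (h : (pT i, [x, u 0, v 0]) ∈ C)
    (hu : ∀ j, (pS, [u j, u (j + 1)]) ∈ C) (hv : ∀ j, (pS, [v j, v (j + 1)]) ∈ C) :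
    (pT i, [x, u (M.ri i), v (M.qi i)]) ∈ C := by
  have hr := hr i
  have hq := hq i
  have key := sat_datalog' (P := pT i) (l := [0, 3, 4]) (hC (ruleT M i) (by
      simp only [RM, Finset.mem_union, Finset.mem_biUnion, Finset.mem_range]
      exact Or.inr ⟨i, hi, by simp⟩))
    (fun n => if n = 0 then x else if n = 1 then u 0 else if n = 2 then v 0 else
      if n = 3 then u (M.ri i) else if n = 4 then v (M.qi i) else
      if n < 11 + M.ri i then u (n - 10) else v (n - (11 + M.ri i))) ?_ ?_ ?_
  · simpa using key
  · intro a ha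
    simp only [ruleT, Finset.mem_union, Finset.mem_singleton] at ha
    rcases ha with (rfl | ha) | ha
    · simpa [applyA, applyT_sb] using h
    · simp only [spath, Finset.mem_image, Finset.mem_range] at ha
      obtain ⟨j, hj, rfl⟩ := ha
      have : ∀ j ≤ M.ri i, applyT (sb (fun n => if n = 0 then x else if n = 1 then u 0 else
        if n = 2 then v 0 else if n = 3 then u (M.ri i) else if n = 4 then v (M.qi i) else
        if n < 11 + M.ri i then u (n - 10) else v (n - (11 + M.ri i))))
          (pathVar 1 3 10 (M.ri i) j) = u j := by
        intro j hj
        unfold pathVar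
        split_ifs with h1 h2
        · subst h1
          simp [applyT_sb]
        · subst h2
          simp [applyT_sb]
        · rw [applyT_sb]
          have e0 : 10 + j ≠ 0 := by omega
          have e1 : 10 + j ≠ 1 := by omega
          have e2 : 10 + j ≠ 2 := by omega
          have e3 : 10 + j ≠ 3 := by omega
          have e4 : 10 + j ≠ 4 := by omega
          have e5 : 10 + j < 11 + M.ri i := by omega
          have e6 : 10 + j - 10 = j := by omega
          simp only [e0, e1, e2, e3, e4, e5, if_false, if_true, e6]
      simp only [applyA, List.map, this j hj.le, this (j + 1) hj]
      exact hu j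
    · simp only [spath, Finset.mem_image, Finset.mem_range] at ha
      obtain ⟨j, hj, rfl⟩ := ha
      have : ∀ j ≤ M.qi i, applyT (sb (fun n => if n = 0 then x else if n = 1 then u 0 else
        if n = 2 then v 0 else if n = 3 then u (M.ri i) else if n = 4 then v (M.qi i) else
        if n < 11 + M.ri i then u (n - 10) else v (n - (11 + M.ri i))))
          (pathVar 2 4 (11 + M.ri i) (M.qi i) j) = v j := by
        intro j hj
        unfold pathVar
        split_ifs with h1 h2
        · subst h1
          simp [applyT_sb]
        · subst h2
          simp [applyT_sb]
        · rw [applyT_sb]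
          have e0 : 11 + M.ri i + j ≠ 0 := by omega
          have e1 : 11 + M.ri i + j ≠ 1 := by omega
          have e2 : 11 + M.ri i + j ≠ 2 := by omega
          have e3 : 11 + M.ri i + j ≠ 3 := by omega
          have e4 : 11 + M.ri i + j ≠ 4 := by omega
          have e5 : ¬ 11 + M.ri i + j < 11 + M.ri i := by omega
          have e6 : 11 + M.ri i + j - (11 + M.ri i) = j := by omega
          simp only [e0, e1, e2, e3, e4, e5, if_false, e6]
      simp only [applyA, List.map, this j hj.le, this (j + 1) hj]
      exact hv j
  · simp [ruleT]
  · intro n hn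
    simp only [ruleT, Finset.mem_union]
    simp at hn
    rcases hn with rfl | rfl | rfl
    · exact ⟨_, Or.inl (Or.inl (Finset.mem_singleton_self _)), by simp⟩
    · obtain ⟨c, hc, h1⟩ := spath_mem_right (a := 1) (b := 3) (base := 10) hr
      exact ⟨c, Or.inl (Or.inr hc), h1⟩
    · obtain ⟨c, hc, h1⟩ := spath_mem_right (a := 2) (b := 4) (base := 11 + M.ri i) hq
      exact ⟨c, Or.inr hc, h1⟩

theorem cloEx (hC : ∀ R ∈ RM M, SatisfiesRule C R) {y z : FTerm} (h : (pG, [y, z]) ∈ C) (h' : (pEnd, [z]) ∈ C) :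
    ∃ x, (pS0, [x, y]) ∈ C ∧ (pR 0, [x, x]) ∈ C ∧ ∀ j < M.p, (pT j, [x, x, x]) ∈ C := by
  obtain ⟨σ, h1, h2⟩ := hC (ruleEx M) (by simp [RM]) (sb (fun n => if n = 1 then y else z)) (by
    intro a ha
    simp only [ruleEx, Finset.coe_insert, Finset.coe_singleton, Set.mem_insert_iff,
      Set.mem_singleton_iff] at ha
    rcases ha with rfl | rfl
    · simpa [applyA, applyT_sb] using h
    · simpa [applyA, applyT_sb] using h')
  have hy : σ (Sum.inl 1) = y := by
    rw [h1 _ (by rw [varsF_ruleEx]; simp)]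
    rfl
  refine ⟨σ (Sum.inl 0), ?_, ?_, ?_⟩
  · rw [← hy]
    exact h2 (pS0, [vt 0, vt 1]) (by simp [ruleEx])
  · exact h2 (pR 0, [vt 0, vt 0]) (by simp [ruleEx])
  · intro j hj
    refine h2 (pT j, [vt 0, vt 0, vt 0]) ?_
    simp only [ruleEx, Finset.coe_union, Set.mem_union, Finset.mem_coe, Finset.mem_biUnion,
      Finset.mem_range]
    exact Or.inr ⟨j, hj, by simp⟩

theorem chain_G (hC : ∀ R ∈ RM M, SatisfiesRule C R) (hp : 0 < M.p) (hr : ∀ i, 0 < M.ri i) (hq : ∀ i, 0 < M.qi i)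
    (hdiv : ∀ k, M.ri (M.gIter k % M.p) ∣ M.gIter k) {y : ℕ → FTerm}
    (hS : ∀ j, (pS, [y j, y (j + 1)]) ∈ C) (hR : (pR 0, [y 0, y 0]) ∈ C)
    (hT : ∀ i < M.p, (pT i, [y 0, y 0, y 0]) ∈ C) (k : ℕ) :
    (pG, [y 0, y (M.gIter k)]) ∈ C := by
  have hR' : ∀ j, (pR (j % M.p), [y 0, y j]) ∈ C := by
    intro j
    induction j with
    | zero => simpa using hR
    | succ j ih =>
      have := cloR hC (Nat.mod_lt j hp) ih (hS j)
      rwa [Nat.mod_add_mod] at this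
  have hT' : ∀ i < M.p, ∀ k, (pT i, [y 0, y (M.ri i * k), y (M.qi i * k)]) ∈ C := by
    intro i hi k
    induction k with
    | zero => simpa using hT i hi
    | succ k ih =>
      exact cloT hC hr hq hi (u := fun j => y (M.ri i * k + j)) (v := fun j => y (M.qi i * k + j))
        ih (fun j => hS _) (fun j => hS _)
  induction k with
  | zero => exact cloGInit hC (hS 0) (hS 1)
  | succ k ih =>
    have hi := Nat.mod_lt (M.gIter k) hp
    obtain ⟨e, he⟩ := hdiv k
    have h1 := hT' _ hi e
    rw [← he] at h1
    have h2 := cloGStep hC hi ih (hR' _) h1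
    have h3 : M.gIter (k + 1) = M.qi (M.gIter k % M.p) * e := by
      rw [show M.gIter (k + 1) = M.g (M.gIter k) from Function.iterate_succ_apply' _ _ _]
      unfold TCM.g
      generalize M.gIter k % M.p = i at *
      rw [he, show M.qi i * (M.ri i * e) = M.ri i * (M.qi i * e) by ring]
      exact Nat.mul_div_cancel_left _ (hr i)
    rw [h3]
    exact h2

theorem chain_exists (hC : ∀ R ∈ RM M, SatisfiesRule C R) (hp : 0 < M.p) (hr : ∀ i, 0 < M.ri i) (hq : ∀ i, 0 < M.qi i)
    (hdiv : ∀ k, M.ri (M.gIter k % M.p) ∣ M.gIter k) (hunb : ∀ n, ∃ k, n ≤ M.gIter k)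
    (hw : (pEnd, [wC]) ∈ C) (hS0 : ∀ x y, (pS0, [x, y]) ∈ C → encode y < encode x) (n : ℕ) :
    ∃ y : ℕ → FTerm, n ≤ encode (y 0) ∧ (∀ j, n ≤ j → y j = wC) ∧
      (∀ j, (pS, [y j, y (j + 1)]) ∈ C) ∧
      (n ≠ 0 → (pR 0, [y 0, y 0]) ∈ C ∧ ∀ i < M.p, (pT i, [y 0, y 0, y 0]) ∈ C) := by
  induction n with
  | zero =>
    exact ⟨fun _ => wC, Nat.zero_le _, fun _ _ => rfl, fun _ => cloSEnd hC hw, by simp⟩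
  | succ n ih =>
    obtain ⟨y, h1, h2, h3, h4⟩ := ih
    have hG : (pG, [y 0, wC]) ∈ C := by
      by_cases hn : n = 0
      · rw [h2 0 (by omega)]
        exact cloFloodG hC (cloFlood hC (cloSEnd hC hw))
      · obtain ⟨h5, h6⟩ := h4 hn
        obtain ⟨k, hk⟩ := hunb n
        have := chain_G hC hp hr hq hdiv h3 h5 h6 k
        rwa [h2 _ hk] at this
    obtain ⟨x, h5, h6, h7⟩ := cloEx hC hG hw
    refine ⟨fun j => match j with | 0 => x | j + 1 => y j, ?_, ?_, ?_, fun _ => ⟨h6, h7⟩⟩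
    · have := hS0 _ _ h5
      show n + 1 ≤ encode x
      omega
    · intro j hj
      obtain ⟨j, rfl⟩ : ∃ k, j = k + 1 := ⟨j - 1, by omega⟩
      exact h2 j (by omega)
    · intro j
      cases j with
      | zero => exact cloS hC h5
      | succ j => exact h3 j

end

theorem S0_encode (M : TCM) {I : Set Atom} (hI : ∀ x y, (pS0, [x, y]) ∉ I)
    (D : Deriv (RM M) I) (n : ℕ) : ∀ x y, (pS0, [x, y]) ∈ D.inst n → encode y < encode x := by
  induction n with
  | zero => exact fun x y h => absurd h (hI x y)
  | succ n ih =>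
    intro x y h
    rcases h with h | h
    · exact ih x y h
    cases hs : D.steps n with
    | none => simp [hs] at h
    | some t =>
      simp only [hs] at h
      obtain ⟨ht, _, _⟩ := D.valid n t hs
      obtain ⟨c, hc, hce⟩ := Finset.mem_image.1 (Finset.mem_coe.1 h)
      have hc1 : c.1 = pS0 := congrArg Prod.fst hce
      have hex : t.rule = ruleEx M → encode y < encode x := by
        intro hr
        have hc' := hc
        rw [hr] at hc'
        simp only [ruleEx, Finset.mem_union, Finset.mem_singleton, Finset.mem_biUnion,
          Finset.mem_range, Finset.mem_insert] at hc'
        rcases hc' with (rfl | rfl) | ⟨j, hj, rfl | rfl⟩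
        · have e1 : applyT t.extSub (vt 1) = t.sub (Sum.inl 1) :=
            extSub_of_mem (a := (pG, [vt 1, vt 2])) (by rw [hr]; simp [ruleEx]) (by simp)
          simp only [applyA, List.map, extSub_ruleEx M t hr, e1, Prod.mk.injEq, List.cons.injEq,
            true_and, and_true] at hce
          rw [← hce.1, ← hce.2]
          exact encode_lt_nul M _ _
        · simp [pR, pS0] at hc1
        · simp only [pT, pS0] at hc1
          omega
      clear hce
      simp only [RM, Finset.mem_union, Finset.mem_insert, Finset.mem_singleton,
        Finset.mem_biUnion, Finset.mem_range] at ht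
      rcases ht with (e | e | e | e | e | e) | ⟨i, hi, e | e | e⟩
      · rw [e] at hc
        simp only [ruleS, Finset.mem_singleton] at hc
        subst hc
        simp [pS, pS0] at hc1
      · rw [e] at hc
        simp only [ruleFloodProp, Finset.mem_singleton] at hc
        subst hc
        simp [pFlood, pS0] at hc1
      · rw [e] at hc
        simp only [ruleSEnd, Finset.mem_singleton] at hc
        subst hc
        simp [pS, pS0] at hc1
      · rw [e] at hc
        simp only [ruleGInit, Finset.mem_singleton] at hc
        subst hc
        simp [pG, pS0] at hc1
      · rw [e] at hc
        simp only [ruleFloodGen, Finset.mem_union, Finset.mem_singleton, Finset.mem_biUnion,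
          Finset.mem_range, Finset.mem_insert] at hc
        rcases hc with rfl | ⟨j, hj, rfl | rfl⟩ <;> simp only [pG, pR, pT, pS0] at hc1 <;> omega
      · exact hex e
      · rw [e] at hc
        simp only [ruleR, Finset.mem_singleton] at hc
        subst hc
        simp only [pR, pS0] at hc1
        omega
      · rw [e] at hc
        simp only [ruleT, Finset.mem_singleton] at hc
        subst hc
        simp only [pT, pS0] at hc1
        omega
      · rw [e] at hc
        simp only [ruleGStep, Finset.mem_singleton] at hc
        subst hc
        simp [pG, pS0] at hc1

theorem all_infinite_of_unbounded (M : TCM) (hp : 0 < M.p) (hr : ∀ i, 0 < M.ri i)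
    (hq : ∀ i, 0 < M.qi i) (hdiv : ∀ k, M.ri (M.gIter k % M.p) ∣ M.gIter k)
    (hunb : ∀ n, ∃ k, n ≤ M.gIter k) (X : ChaseVariant)
    (D : Deriv (RM M) (({(pEnd, [wC])} : Finset Atom) : Set Atom)) (hF : D.Fair X) :
    ¬ D.Finite := by
  intro hfin
  obtain ⟨N, C, hCN, hmod, σ, hσ⟩ := exists_model (Finset.finite_toSet _) X D hF hfin
  have hw : (pEnd, [wC]) ∈ C := by
    have h := hσ (pEnd, [wC]) (instSeq_mono _ _ (Nat.zero_le N) (by simp [instSeq]))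
    exact h
  have hS0 := S0_encode M (by simp [pEnd, pS0]) D N
  have hCf : C.Finite := (inst_finite (Finset.finite_toSet _) D N).subset hCN
  obtain ⟨L, hL⟩ : ∃ L, ∀ a ∈ hCf.toFinset, ∀ t ∈ a.2, encode t ≤ L := by
    refine ⟨∑ a ∈ hCf.toFinset, encode a.2, fun a ha t ht => ?_⟩
    refine (encode_list_mem _ _ ht).le.trans ?_
    exact Finset.single_le_sum (f := fun a : Atom => encode a.2) (fun _ _ => Nat.zero_le _) ha
  obtain ⟨y, h1, _, h3, _⟩ := chain_exists hmod hp hr hq hdiv hunb hw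
    (fun x y h => hS0 x y (hCN h)) (L + 1)
  have := hL _ ((Set.Finite.mem_toFinset hCf).2 (h3 0)) (y 0) (by simp)
  omega

/-! ### The prime encoding -/

theorem prm_prime (i : ℕ) : (prm i).Prime := by
  cases i with
  | zero => exact Nat.prime_two
  | succ k => exact (Nat.find_spec (Nat.exists_infinite_primes (prm k + 1))).2

theorem prm_strictMono : StrictMono prm := by
  refine strictMono_nat_of_lt_succ fun k => ?_
  have := (Nat.find_spec (Nat.exists_infinite_primes (prm k + 1))).1
  exact this

theorem prm_dvd_prm {i j : ℕ} : prm i ∣ prm j ↔ i = j := by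
  rw [Nat.prime_dvd_prime_iff_eq (prm_prime i) (prm_prime j)]
  exact prm_strictMono.injective.eq_iff

theorem prm_dvd_pow {i j v : ℕ} : prm i ∣ prm j ^ v ↔ i = j ∧ v ≠ 0 := by
  constructor
  · intro h
    refine ⟨prm_dvd_prm.1 ((prm_prime i).dvd_of_dvd_pow h), ?_⟩
    rintro rfl
    have := (prm_prime i).one_lt
    simp at h
    omega
  · rintro ⟨rfl, h⟩
    exact dvd_pow_self _ h

theorem M_p_pos (M : TCM) : 0 < M.p := Finset.prod_pos fun i _ => (prm_prime i).pos

theorem prm_dvd_p (M : TCM) {j : ℕ} (h : j < M.m + 3) : prm j ∣ M.p :=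
  Finset.dvd_prod_of_mem _ (Finset.mem_range.2 h)

theorem prm_dvd_enc (M : TCM) (C : Config) (j : ℕ) (hj : j < M.m + 3) :
    prm j ∣ M.enc C % M.p ↔ j = C.1 ∨ (j = M.m ∧ C.2.1 ≠ 0) ∨ (j = M.m + 1 ∧ C.2.2.1 ≠ 0) ∨
      (j = M.m + 2 ∧ C.2.2.2 ≠ 0) := by
  rw [Nat.dvd_mod_iff (prm_dvd_p M hj)]
  unfold TCM.enc
  rw [(prm_prime j).dvd_mul, (prm_prime j).dvd_mul, (prm_prime j).dvd_mul, prm_dvd_prm,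
    prm_dvd_pow, prm_dvd_pow, prm_dvd_pow]
  tauto

theorem stateOf_enc (M : TCM) (C : Config) (hC : C.1 < M.m) :
    M.stateOf (M.enc C % M.p) = some C.1 := by
  unfold TCM.stateOf
  cases h : (List.range M.m).find? fun s => decide (prm s ∣ M.enc C % M.p) with
  | none =>
    rw [List.find?_eq_none] at h
    have := h C.1 (List.mem_range.2 hC)
    simp only [decide_eq_true_eq] at this
    exact absurd ((prm_dvd_enc M C C.1 (by omega)).2 (Or.inl rfl)) this
  | some s =>
    have h1 := List.find?_some h
    have h2 := List.mem_range.1 (List.mem_of_find?_eq_some h)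
    simp only [decide_eq_true_eq] at h1
    rw [prm_dvd_enc M C s (by omega)] at h1
    congr 1
    omega

theorem qr_pos (M : TCM) (i : ℕ) : 0 < (M.qr i).1 ∧ 0 < (M.qr i).2 := by
  unfold TCM.qr
  split
  · simp
  · dsimp only
    split
    · simp
    · rename_i s _ _ s' d1 d2 _
      have hp := fun i => (prm_prime i).pos
      have key : ∀ n d : ℕ, 0 < n → 0 < d → 0 < n / Nat.gcd n d ∧ 0 < d / Nat.gcd n d := by
        intro n d hn hd
        have hg := Nat.gcd_pos_of_pos_left d hn
        exact ⟨Nat.div_pos (Nat.le_of_dvd hn (Nat.gcd_dvd_left _ _)) hg,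
          Nat.div_pos (Nat.le_of_dvd hd (Nat.gcd_dvd_right _ _)) hg⟩
      have hif : ∀ (c : Prop) [Decidable c] i, 0 < (if c then prm i else 1) := by
        intro c _ i
        split_ifs
        · exact hp i
        · exact one_pos
      refine key _ _ ?_ ?_
      · exact Nat.mul_pos (Nat.mul_pos (Nat.mul_pos (hp _) (hp _)) (hif _ _)) (hif _ _)
      · exact Nat.mul_pos (Nat.mul_pos (hp _) (hif _ _)) (hif _ _)

theorem qi_pos (M : TCM) (i : ℕ) : 0 < M.qi i := (qr_pos M i).1
theorem ri_pos (M : TCM) (i : ℕ) : 0 < M.ri i := (qr_pos M i).2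

theorem step_wf (M : TCM) {q : ℕ} {b1 b2 : Bool} {r : ℕ × Int × Int}
    (h : M.step q b1 b2 = some r) :
    r.1 < M.m ∧ r.2.1.natAbs ≤ 1 ∧ r.2.2.natAbs ≤ 1 := by
  unfold TCM.step at h
  rw [Option.map_eq_some_iff] at h
  obtain ⟨e, he, rfl⟩ := h
  exact (M.wf e (List.mem_of_find?_eq_some he)).2

theorem pow_shift (P v : ℕ) (d : ℤ) (hd : d.natAbs ≤ 1) (e : ℤ)
    (he : e = if v ≠ 0 then d else max d 0) :
    (if e = 1 then P else 1) * P ^ v = (if e = -1 then P else 1) * P ^ ((v : ℤ) + d).toNat := by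
  have hd' : d = -1 ∨ d = 0 ∨ d = 1 := by omega
  rcases hd' with rfl | rfl | rfl
  · cases v with
    | zero => subst he; simp
    | succ v =>
      have : (((v + 1 : ℕ) : ℤ) + -1).toNat = v := by omega
      rw [this]
      simp at he
      subst he
      simp [pow_succ, mul_comm]
  · have : ((v : ℤ) + 0).toNat = v := by omega
    rw [this]
    have he : e = 0 := by rw [he]; split_ifs <;> simp
    subst he
    simp
  · have : ((v : ℤ) + 1).toNat = v + 1 := by omega
    rw [this]
    have he : e = 1 := by rw [he]; split_ifs <;> simp
    subst he
    simp [pow_succ, mul_comm]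

theorem g_enc (M : TCM) (C : Config) (hC : C.1 < M.m) :
    M.ri (M.enc C % M.p) ∣ M.enc C ∧
    (M.next C = none → M.g (M.enc C) = M.enc C) ∧
    (∀ C', M.next C = some C' → M.g (M.enc C) = M.enc C' ∧ C'.1 < M.m ∧
      C'.2.2.2 = C.2.2.2 + 1) := by
  obtain ⟨i, hi⟩ : ∃ i, i = M.enc C % M.p := ⟨_, rfl⟩
  have hb1 : decide (prm M.m ∣ i) = decide (C.2.1 ≠ 0) := by
    rw [decide_eq_decide, hi, prm_dvd_enc M C _ (by omega)]
    constructor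
    · intro h
      omega
    · intro h
      exact Or.inr (Or.inl ⟨rfl, h⟩)
  have hb2 : decide (prm (M.m + 1) ∣ i) = decide (C.2.2.1 ≠ 0) := by
    rw [decide_eq_decide, hi, prm_dvd_enc M C _ (by omega)]
    constructor
    · intro h
      omega
    · intro h
      exact Or.inr (Or.inr (Or.inl ⟨rfl, h⟩))
  have hst := stateOf_enc M C hC
  unfold TCM.g
  rw [← hi] at hst ⊢
  cases hs : M.step C.1 (decide (C.2.1 ≠ 0)) (decide (C.2.2.1 ≠ 0)) with
  | none =>
    have hq : M.qr i = (1, 1) := by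
      unfold TCM.qr
      rw [hst]
      dsimp only
      rw [hb1, hb2, hs]
    have hn : M.next C = none := by
      unfold TCM.next
      rw [hs]
    have h1 : M.qi i = 1 := by unfold TCM.qi; rw [hq]
    have h2 : M.ri i = 1 := by unfold TCM.ri; rw [hq]
    rw [h1, h2, hn]
    simp
  | some r =>
    obtain ⟨s', d1, d2⟩ := r
    obtain ⟨hs', hd1, hd2⟩ := step_wf M hs
    have hn : M.next C = some (s', ((C.2.1 : ℤ) + d1).toNat, ((C.2.2.1 : ℤ) + d2).toNat,
        C.2.2.2 + 1) := by
      unfold TCM.next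
      rw [hs]
    obtain ⟨num, den, hq, hnum, hden⟩ : ∃ num den : ℕ,
        M.qr i = (num / Nat.gcd num den, den / Nat.gcd num den) ∧
        0 < num ∧ num * M.enc C = den * M.enc (s', ((C.2.1 : ℤ) + d1).toNat,
          ((C.2.2.1 : ℤ) + d2).toNat, C.2.2.2 + 1) := by
      have hqr : M.qr i = M.qr i := rfl
      conv_rhs at hqr =>
        unfold TCM.qr
        rw [hst]
        dsimp only
        rw [hb1, hb2, hs]
        dsimp only
      refine ⟨_, _, hqr, ?_, ?_⟩
      · have hif : ∀ (c : Prop) [Decidable c] i, 0 < (if c then prm i else 1) := by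
          intro c _ i
          split_ifs
          · exact (prm_prime i).pos
          · exact one_pos
        exact Nat.mul_pos (Nat.mul_pos (Nat.mul_pos (prm_prime _).pos (prm_prime _).pos)
          (hif _ _)) (hif _ _)
      · generalize he1 : (if decide (C.2.1 ≠ 0) = true then d1 else max d1 0) = e1
        generalize he2 : (if decide (C.2.2.1 ≠ 0) = true then d2 else max d2 0) = e2
        simp only [decide_eq_true_eq] at he1 he2
        have k1 := pow_shift (prm M.m) C.2.1 d1 hd1 e1 he1.symm
        have k2 := pow_shift (prm (M.m + 1)) C.2.2.1 d2 hd2 e2 he2.symm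
        unfold TCM.enc
        dsimp only
        rw [pow_succ]
        calc _ = prm s' * prm C.1 * prm (M.m + 2) ^ C.2.2.2 * prm (M.m + 2) *
              (((if e1 = 1 then prm M.m else 1) * prm M.m ^ C.2.1) *
              ((if e2 = 1 then prm (M.m + 1) else 1) * prm (M.m + 1) ^ C.2.2.1)) := by ring
          _ = _ := by
            rw [k1, k2]
            ring
    set C' : Config := (s', ((C.2.1 : ℤ) + d1).toNat, ((C.2.2.1 : ℤ) + d2).toNat, C.2.2.2 + 1)
    have hg := Nat.gcd_pos_of_pos_left den hnum
    have h1 : M.qi i = num / Nat.gcd num den := by unfold TCM.qi; rw [hq]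
    have h2 : M.ri i = den / Nat.gcd num den := by unfold TCM.ri; rw [hq]
    have hcop : Nat.Coprime (M.qi i) (M.ri i) := by
      rw [h1, h2]
      exact Nat.coprime_div_gcd_div_gcd hg
    have heq : M.qi i * M.enc C = M.ri i * M.enc C' := by
      apply Nat.eq_of_mul_eq_mul_left hg
      rw [← mul_assoc, ← mul_assoc, h1, h2, Nat.mul_div_cancel' (Nat.gcd_dvd_left _ _),
        Nat.mul_div_cancel' (Nat.gcd_dvd_right _ _), hden]
    have hdvd : M.ri i ∣ M.enc C :=
      hcop.symm.dvd_of_dvd_mul_left (heq ▸ Dvd.intro _ rfl)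
    refine ⟨hdvd, fun h => by rw [hn] at h; simp at h, ?_⟩
    intro C'' hC''
    rw [hn] at hC''
    cases hC''
    refine ⟨?_, hs', rfl⟩
    rw [heq]
    exact Nat.mul_div_cancel_left _ (ri_pos M i)

theorem gIter_succ (M : TCM) (k : ℕ) : M.gIter (k + 1) = M.g (M.gIter k) :=
  Function.iterate_succ_apply' _ _ _

theorem gIter_run (M : TCM) (k : ℕ) (C : Config) (h : M.run k = some C) :
    M.gIter k = M.enc C ∧ C.1 < M.m ∧ C.2.2.2 = k := by
  induction k generalizing C with
  | zero =>
    simp only [TCM.run, Option.some.injEq] at h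
    subst h
    refine ⟨?_, M.hm, rfl⟩
    simp [TCM.gIter, TCM.enc, prm]
  | succ k ih =>
    rw [TCM.run, Option.bind_eq_some_iff] at h
    obtain ⟨C0, h0, h1⟩ := h
    obtain ⟨i1, i2, i3⟩ := ih C0 h0
    obtain ⟨j1, j2, j3⟩ := (g_enc M C0 i2).2.2 C h1
    refine ⟨?_, j2, by rw [j3, i3]⟩
    rw [gIter_succ, i1, j1]

theorem bounded_of_halts (M : TCM) (h : M.Halts) : ∃ B, ∀ d ∈ M.Gset, d ≤ B := by
  obtain ⟨n, C, h1, h2⟩ := h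
  obtain ⟨i1, i2, _⟩ := gIter_run M n C h1
  have hfix : ∀ k, M.gIter (n + k) = M.gIter n := by
    intro k
    induction k with
    | zero => rfl
    | succ k ih =>
      rw [← Nat.add_assoc, gIter_succ, ih, i1]
      exact (g_enc M C i2).2.1 h2
  refine ⟨∑ j ∈ Finset.range (n + 1), M.gIter j, ?_⟩
  rintro _ ⟨k, rfl⟩
  have hle : ∀ j ≤ n, M.gIter j ≤ ∑ j ∈ Finset.range (n + 1), M.gIter j := fun j hj =>
    Finset.single_le_sum (f := M.gIter) (fun _ _ => Nat.zero_le _)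
      (Finset.mem_range.2 (by omega))
  by_cases hk : k ≤ n
  · exact hle k hk
  · obtain ⟨j, rfl⟩ : ∃ j, k = n + j := ⟨k - n, by omega⟩
    rw [hfix]
    exact hle n le_rfl

theorem run_of_not_halts (M : TCM) (h : ¬ M.Halts) (k : ℕ) : ∃ C, M.run k = some C := by
  induction k with
  | zero => exact ⟨_, rfl⟩
  | succ k ih =>
    obtain ⟨C, hC⟩ := ih
    cases hn : M.next C with
    | none => exact absurd ⟨k, C, hC, hn⟩ h
    | some C' => exact ⟨C', by rw [TCM.run, hC, Option.bind_some, hn]⟩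

theorem CT_iff_halts (M : TCM) (X : ChaseVariant) (Q : CTQuant) :
    CT X Q (RM M) ↔ M.Halts := by
  constructor
  · intro hc
    by_contra h
    refine not_CT_of_all_infinite (RM M) X {(pEnd, [wC])} (fun D hD => ?_) Q hc
    refine all_infinite_of_unbounded M (M_p_pos M) (ri_pos M) (qi_pos M) ?_ ?_ X D hD
    · intro k
      obtain ⟨C, hC⟩ := run_of_not_halts M h k
      obtain ⟨h1, h2, _⟩ := gIter_run M k C hC
      rw [h1]
      exact (g_enc M C h2).1
    · intro n
      obtain ⟨C, hC⟩ := run_of_not_halts M h n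
      obtain ⟨h1, _, h3⟩ := gIter_run M n C hC
      refine ⟨n, ?_⟩
      rw [h1]
      unfold TCM.enc
      rw [h3]
      have hp := fun i => (prm_prime i).pos
      refine (Nat.lt_pow_self (prm_prime (M.m + 2)).one_lt).le.trans ?_
      exact Nat.le_mul_of_pos_left _ (Nat.mul_pos (Nat.mul_pos (hp _) (Nat.pow_pos (hp _)))
        (Nat.pow_pos (hp _)))
  · intro h
    obtain ⟨B, hB⟩ := bounded_of_halts M h
    exact CT_of_all_finite _ (all_finite_of_bounded M B hB (ri_pos M) (qi_pos M)) X Q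

theorem encodeTCM_injective : Function.Injective encodeTCM := by
  intro M M' h
  have h := Encodable.encode_injective h
  rw [Prod.mk.injEq] at h
  cases M
  cases M'
  simp only at h
  obtain ⟨rfl, rfl⟩ := h
  rfl

/-! ### Abstract two-counter machines and their compilation to 3CMs -/

open StateTransition

def step2 {Q : Type} (st : Q → Bool → Bool → Option (Q × ℤ × ℤ)) (c : Q × ℕ × ℕ) :
    Option (Q × ℕ × ℕ) :=
  (st c.1 (decide (c.2.1 ≠ 0)) (decide (c.2.2 ≠ 0))).map fun r =>
    (r.1, ((c.2.1 : ℤ) + r.2.1).toNat, ((c.2.2 : ℤ) + r.2.2).toNat)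

theorem halts_iff_eval (M : TCM) : M.Halts ↔ (eval M.next (0, 0, 0, 0)).Dom := by
  have h1 : ∀ n C, M.run n = some C → Reaches M.next (0, 0, 0, 0) C := by
    intro n
    induction n with
    | zero =>
      intro C h
      simp only [TCM.run, Option.some.injEq] at h
      subst h
      exact Relation.ReflTransGen.refl
    | succ n ih =>
      intro C h
      rw [TCM.run, Option.bind_eq_some_iff] at h
      obtain ⟨C0, h0, h1⟩ := h
      exact (ih C0 h0).tail h1
  have h2 : ∀ C, Reaches M.next (0, 0, 0, 0) C → ∃ n, M.run n = some C := by
    intro C h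
    induction h with
    | refl => exact ⟨0, rfl⟩
    | @tail b c _ hbc ih =>
      obtain ⟨n, hn⟩ := ih
      refine ⟨n + 1, ?_⟩
      rw [TCM.run, hn, Option.bind_some]
      exact hbc
  rw [Part.dom_iff_mem]
  constructor
  · rintro ⟨n, C, h, h'⟩
    exact ⟨C, mem_eval.2 ⟨h1 n C h, h'⟩⟩
  · rintro ⟨C, hC⟩
    obtain ⟨h, h'⟩ := mem_eval.1 hC
    obtain ⟨n, hn⟩ := h2 C h
    exact ⟨n, C, hn, h'⟩

theorem step_eq_some_iff (M : TCM) (q : ℕ) (b1 b2 : Bool) (r : ℕ × ℤ × ℤ) :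
    M.step q b1 b2 = some r ↔ ((q, b1, b2), r) ∈ M.δ := by
  unfold TCM.step
  rw [Option.map_eq_some_iff]
  constructor
  · rintro ⟨e, he, rfl⟩
    have h1 := List.find?_some he
    simp only [decide_eq_true_eq] at h1
    rw [← h1]
    exact List.mem_of_find?_eq_some he
  · intro h
    cases hf : M.δ.find? fun e => decide (e.1 = (q, b1, b2)) with
    | none =>
      rw [List.find?_eq_none] at hf
      exact absurd (hf _ h) (by simp)
    | some e =>
      have h1 := List.find?_some hf
      simp only [decide_eq_true_eq] at h1
      have := List.inj_on_of_nodup_map M.keys_nodup (List.mem_of_find?_eq_some hf) h h1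
      exact ⟨e, rfl, by rw [this]⟩

def preList (E e0 : ℕ) : List ((ℕ × Bool × Bool) × (ℕ × Int × Int)) :=
  (List.range E).map fun i =>
    ((2 * i, bif i == 0 then false else true, false),
      (bif i + 1 == E then e0 else 2 * (i + 1), 1, 0))

section compile
variable {Q : Type} (st : Q → Bool → Bool → Option (Q × ℤ × ℤ)) (S : Finset Q) (num : Q → ℕ)

def table : Finset ((ℕ × Bool × Bool) × (ℕ × Int × Int)) :=
  (S ×ˢ (Finset.univ : Finset (Bool × Bool))).biUnion fun x =>
    ((st x.1 x.2.1 x.2.2).map fun r =>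
      ((2 * num x.1 + 1, x.2.1, x.2.2), (2 * num r.1 + 1, r.2.1, r.2.2))).toFinset

theorem mem_table (e : (ℕ × Bool × Bool) × (ℕ × Int × Int)) :
    e ∈ table st S num ↔ ∃ q ∈ S, ∃ b1 b2 r, st q b1 b2 = some r ∧
      e = ((2 * num q + 1, b1, b2), (2 * num r.1 + 1, r.2.1, r.2.2)) := by
  unfold table
  rw [Finset.mem_biUnion]
  constructor
  · rintro ⟨⟨q, b1, b2⟩, hx, he⟩
    rw [Option.mem_toFinset, Option.mem_def, Option.map_eq_some_iff] at he
    obtain ⟨r, hr, rfl⟩ := he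
    exact ⟨q, (Finset.mem_product.1 hx).1, b1, b2, r, hr, rfl⟩
  · rintro ⟨q, hq, b1, b2, r, hr, rfl⟩
    refine ⟨(q, b1, b2), Finset.mem_product.2 ⟨hq, Finset.mem_univ _⟩, ?_⟩
    rw [Option.mem_toFinset, Option.mem_def, Option.map_eq_some_iff]
    exact ⟨r, hr, rfl⟩

theorem exists_compile (hcl : ∀ q ∈ S, ∀ b1 b2 r, st q b1 b2 = some r →
      r.1 ∈ S ∧ r.2.1.natAbs ≤ 1 ∧ r.2.2.natAbs ≤ 1) (K : ℕ) (hK : ∀ q ∈ S, num q < K)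
    (hinj : Set.InjOn num S) (q0 : Q) (hq0 : q0 ∈ S) (E : ℕ) (hE : 0 < E) :
    ∃ M : TCM, M.m = 2 * E + 2 * K + 2 ∧
      M.δ = preList E (2 * num q0 + 1) ++ (table st S num).toList ∧
      (M.Halts ↔ (eval (step2 st) (q0, E, 0)).Dom) := by
  have hnd : ((preList E (2 * num q0 + 1) ++ (table st S num).toList).map Prod.fst).Nodup := by
    rw [List.map_append, List.nodup_append]
    refine ⟨?_, ?_, ?_⟩
    · unfold preList
      rw [List.map_map]
      refine List.Nodup.map ?_ List.nodup_range
      intro i j hij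
      simp at hij
      exact hij.1
    · refine List.Nodup.map_on ?_ (Finset.nodup_toList _)
      intro e he e' he' h
      rw [Finset.mem_toList, mem_table] at he he'
      obtain ⟨q, hq, b1, b2, r, hr, rfl⟩ := he
      obtain ⟨q', hq', b1', b2', r', hr', rfl⟩ := he'
      simp only [Prod.mk.injEq] at h
      obtain ⟨h1, rfl, rfl⟩ := h
      have : q = q' := hinj hq hq' (by omega)
      subst this
      rw [hr] at hr'
      cases hr'
      rfl
    · intro a ha b hb hab
      subst hab
      obtain ⟨e, he, rfl⟩ := List.mem_map.1 ha
      obtain ⟨e', he', h⟩ := List.mem_map.1 hb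
      rw [Finset.mem_toList, mem_table] at he'
      obtain ⟨q', hq', b1', b2', r', hr', rfl⟩ := he'
      obtain ⟨i, hi, rfl⟩ := List.mem_map.1 he
      simp only [Prod.mk.injEq] at h
      omega
  have hwf : ∀ e ∈ preList E (2 * num q0 + 1) ++ (table st S num).toList,
      e.1.1 < 2 * E + 2 * K + 2 ∧ e.2.1 < 2 * E + 2 * K + 2 ∧
        e.2.2.1.natAbs ≤ 1 ∧ e.2.2.2.natAbs ≤ 1 := by
    intro e he
    rcases List.mem_append.1 he with he | he
    · obtain ⟨i, hi, rfl⟩ := List.mem_map.1 he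
      have := List.mem_range.1 hi
      have := hK q0 hq0
      refine ⟨by dsimp only; omega, ?_, by simp, by simp⟩
      dsimp only
      cases i + 1 == E <;> simp <;> omega
    · rw [Finset.mem_toList, mem_table] at he
      obtain ⟨q, hq, b1, b2, r, hr, rfl⟩ := he
      obtain ⟨h1, h2, h3⟩ := hcl q hq b1 b2 r hr
      have := hK q hq
      have := hK _ h1
      exact ⟨by dsimp only; omega, by dsimp only; omega, h2, h3⟩
  refine ⟨⟨2 * E + 2 * K + 2, by omega, _, hnd, hwf⟩, rfl, rfl, ?_⟩
  set M : TCM := ⟨2 * E + 2 * K + 2, by omega, _, hnd, hwf⟩ with hM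
  have hMs := step_eq_some_iff M
  have hmem : ∀ e, e ∈ M.δ ↔ e ∈ preList E (2 * num q0 + 1) ∨ e ∈ table st S num := by
    intro e
    rw [← Finset.mem_toList (s := table st S num)]
    exact List.mem_append
  have hpre : ∀ i < E, M.next (2 * i, i, 0, i) =
      some (if i + 1 = E then 2 * num q0 + 1 else 2 * (i + 1), i + 1, 0, i + 1) := by
    intro i hi
    have : M.step (2 * i) (decide (i ≠ 0)) (decide (0 ≠ 0)) =
        some (if i + 1 = E then 2 * num q0 + 1 else 2 * (i + 1), 1, 0) := by
      rw [hMs, hmem]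
      refine Or.inl (List.mem_map.2 ⟨i, List.mem_range.2 hi, ?_⟩)
      have e1 : (bif i == 0 then false else true) = decide (i ≠ 0) := by
        cases i <;> simp
      have e2 : decide (0 ≠ 0) = false := by simp
      have e3 : (bif i + 1 == E then 2 * num q0 + 1 else 2 * (i + 1)) =
          if i + 1 = E then 2 * num q0 + 1 else 2 * (i + 1) := by
        by_cases h : i + 1 = E
        · rw [if_pos h, beq_iff_eq.2 h]; rfl
        · rw [if_neg h, beq_eq_false_iff_ne.2 h]; rfl
      rw [e1, e2, e3]
    unfold TCM.next
    dsimp only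
    rw [this]
    dsimp only
    congr 3
  have hreach : Reaches M.next (0, 0, 0, 0) (2 * num q0 + 1, E, 0, E) := by
    have : ∀ i < E, Reaches M.next (0, 0, 0, 0) (2 * i, i, 0, i) := by
      intro i
      induction i with
      | zero => intro _; exact Relation.ReflTransGen.refl
      | succ i ih =>
        intro hi
        refine (ih (by omega)).tail ?_
        rw [Option.mem_def, hpre i (by omega), if_neg (by omega)]
    obtain ⟨i, rfl⟩ : ∃ i, E = i + 1 := ⟨E - 1, by omega⟩
    refine (this i (by omega)).tail ?_
    rw [Option.mem_def, hpre i (by omega), if_pos rfl]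
  rw [halts_iff_eval, reaches_eval hreach]
  have hresp : Respects (step2 st) M.next (fun (c : Q × ℕ × ℕ) (C : Config) =>
      c.1 ∈ S ∧ ∃ t, C = (2 * num c.1 + 1, c.2.1, c.2.2, t)) := by
    rintro ⟨q, c1, c2⟩ C ⟨hq, t, rfl⟩
    dsimp only at hq ⊢
    have hst : M.step (2 * num q + 1) (decide (c1 ≠ 0)) (decide (c2 ≠ 0)) =
        (st q (decide (c1 ≠ 0)) (decide (c2 ≠ 0))).map fun r =>
          (2 * num r.1 + 1, r.2.1, r.2.2) := by
      generalize decide (c1 ≠ 0) = b1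
      generalize decide (c2 ≠ 0) = b2
      ext r
      rw [hMs, hmem, Option.map_eq_some_iff, mem_table]
      constructor
      · rintro (h | h)
        · obtain ⟨i, hi, h⟩ := List.mem_map.1 h
          simp only [Prod.mk.injEq] at h
          omega
        · obtain ⟨q', hq', b1', b2', r', hr', h⟩ := h
          simp only [Prod.mk.injEq] at h
          obtain ⟨⟨h1, rfl, rfl⟩, rfl⟩ := h
          have : q = q' := hinj hq hq' (by omega)
          subst this
          exact ⟨r', hr', rfl⟩
      · rintro ⟨r', hr', rfl⟩
        exact Or.inr ⟨q, hq, b1, b2, r', hr', rfl⟩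
    unfold step2 TCM.next
    dsimp only
    rw [hst]
    cases hs : st q (decide (c1 ≠ 0)) (decide (c2 ≠ 0)) with
    | none => simp
    | some r =>
      simp only [Option.map_some]
      exact ⟨_, ⟨(hcl q hq _ _ r hs).1, t + 1, rfl⟩, Relation.TransGen.single (by
        simp only [Option.mem_def, hst, hs, Option.map_some])⟩
  exact tr_eval_dom hresp ⟨hq0, E, rfl⟩

end compile

theorem exists_num {Q : Type} (S : Finset Q) : ∃ (num : Q → ℕ) (K : ℕ),
    (∀ q ∈ S, num q < K) ∧ Set.InjOn num S := by
  refine ⟨fun q => if h : q ∈ S then S.equivFin ⟨q, h⟩ else 0, S.card, ?_, ?_⟩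
  · intro q hq
    simp [hq]
  · intro q hq q' hq' h
    have hq := Finset.mem_coe.1 hq
    have hq' := Finset.mem_coe.1 hq'
    simp only [hq, hq', dif_pos] at h
    have := S.equivFin.injective (Fin.ext h)
    simpa using this

theorem preList_computable (e0 : ℕ) : Computable fun E => preList E e0 := by
  refine Primrec.to_comp ?_
  unfold preList
  refine Primrec.list_map Primrec.list_range ?_
  have hi : Primrec fun x : ℕ × ℕ => x.2 := Primrec.snd
  have h1 : Primrec fun x : ℕ × ℕ => 2 * x.2 := Primrec.nat_mul.comp (Primrec.const 2) hi
  have h2 : Primrec fun x : ℕ × ℕ => (bif x.2 == 0 then false else true) :=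
    Primrec.cond (Primrec.beq.comp hi (Primrec.const 0)) (Primrec.const _) (Primrec.const _)
  have hs : Primrec fun x : ℕ × ℕ => x.2 + 1 := Primrec.succ.comp hi
  have h3 : Primrec fun x : ℕ × ℕ => (bif x.2 + 1 == x.1 then e0 else 2 * (x.2 + 1)) :=
    Primrec.cond (Primrec.beq.comp hs Primrec.fst) (Primrec.const _)
      (Primrec.nat_mul.comp (Primrec.const 2) hs)
  exact Primrec.pair (Primrec.pair h1 (Primrec.pair h2 (Primrec.const _)))
    (Primrec.pair h3 (Primrec.const ((1 : ℤ), (0 : ℤ))))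

/-- Undecidability transfers through the compilation. -/
theorem computable_halting {Q : Type} (st : Q → Bool → Bool → Option (Q × ℤ × ℤ))
    (S : Finset Q) (hcl : ∀ q ∈ S, ∀ b1 b2 r, st q b1 b2 = some r →
      r.1 ∈ S ∧ r.2.1.natAbs ≤ 1 ∧ r.2.2.natAbs ≤ 1) (q0 : Q) (hq0 : q0 ∈ S)
    (f : ℕ → Bool) (hf : Computable f) (hfM : ∀ M : TCM, f (encodeTCM M) = true ↔ M.Halts)
    (E : ℕ → ℕ) (hE : Computable E) (hE0 : ∀ n, 0 < E n) :
    ∃ g : ℕ → Bool, Computable g ∧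
      ∀ n, g n = true ↔ (eval (step2 st) (q0, E n, 0)).Dom := by
  obtain ⟨num, K, hK, hinj⟩ := exists_num S
  choose M hM1 hM2 hM3 using fun n =>
    exists_compile st S num hcl K hK hinj q0 hq0 (E n) (hE0 n)
  refine ⟨fun n => f (encodeTCM (M n)), hf.comp ?_, fun n => by rw [hfM, hM3]⟩
  have h1 : (fun n => encodeTCM (M n)) = fun n => Encodable.encode
      (2 * E n + 2 * K + 2, preList (E n) (2 * num q0 + 1) ++ (table st S num).toList) := by
    funext n
    unfold encodeTCM
    rw [hM1, hM2]
  rw [h1]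
  have ha : Computable fun n => 2 * E n + 2 * K + 2 := by
    have : Primrec fun x : ℕ => 2 * x + 2 * K + 2 :=
      Primrec.nat_add.comp (Primrec.nat_add.comp
        (Primrec.nat_mul.comp (Primrec.const 2) Primrec.id) (Primrec.const _)) (Primrec.const _)
    exact this.to_comp.comp hE
  have hb : Computable fun n =>
      preList (E n) (2 * num q0 + 1) ++ (table st S num).toList :=
    Computable.list_append.comp ((preList_computable _).comp hE) (Computable.const _)
  exact Computable.encode.comp (ha.pair hb)

/-! ### Fractran-like machines and their simulation by two-counter machines -/

structure FInstr (L : Type) where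
  den : ℕ
  num : ℕ
  l1 : L
  mul : ℕ
  l2 : L

open StateTransition

def stepF {L : Type} (prog : L → Option (FInstr L)) (c : L × ℕ) : Option (L × ℕ) :=
  (prog c.1).map fun I => if c.2 % I.den = 0 then (I.l1, c.2 / I.den * I.num) else (I.l2, c.2 * I.mul)

def FInstr.aj {L : Type} (I : FInstr L) (j : ℕ) : ℕ := if j = 0 then I.num else I.den * I.mul
def FInstr.bj {L : Type} (I : FInstr L) (j : ℕ) : ℕ := if j = 0 then 0 else j * I.mul
def FInstr.lj {L : Type} (I : FInstr L) (j : ℕ) : L := if j = 0 then I.l1 else I.l2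

def stF {L : Type} (prog : L → Option (FInstr L)) :
    L × ℕ × Option ℕ → Bool → Bool → Option ((L × ℕ × Option ℕ) × ℤ × ℤ)
  | (l, j, none), b1, _ => (prog l).map fun I =>
      if b1 = true then
        if j + 1 < I.den then ((l, j + 1, none), -1, 0) else ((l, 0, none), -1, 1)
      else ((l, j, some (I.bj j)), 0, 0)
  | (l, j, some (i + 1)), _, _ => some ((l, j, some i), 1, 0)
  | (l, j, some 0), _, b2 => (prog l).map fun I =>
      if b2 = true then ((l, j, some (I.aj j)), 0, -1) else ((I.lj j, 0, none), 0, 0)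

section
variable {L : Type} {prog : L → Option (FInstr L)} {l : L} {I : FInstr L}

theorem stF_cons (hI : prog l = some I) (n : ℕ) : ∀ j c2, j < I.den →
    Reaches (step2 (stF prog)) ((l, j, none), n, c2)
      ((l, (j + n) % I.den, none), 0, c2 + (j + n) / I.den) := by
  induction n with
  | zero =>
    intro j c2 hj
    rw [Nat.add_zero, Nat.mod_eq_of_lt hj, Nat.div_eq_of_lt hj]
    exact Relation.ReflTransGen.refl
  | succ n ih =>
    intro j c2 hj
    by_cases h : j + 1 < I.den
    · refine Relation.ReflTransGen.head (b := ((l, j + 1, none), n, c2)) ?_ ?_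
      · simp [step2, stF, hI, h]
      · have := ih (j + 1) c2 h
        rwa [show j + 1 + n = j + (n + 1) by omega] at this
    · have hd : j + 1 = I.den := by omega
      refine Relation.ReflTransGen.head (b := ((l, 0, none), n, c2 + 1)) ?_ ?_
      · simp [step2, stF, hI, h]
      · have := ih 0 (c2 + 1) (by omega)
        rw [show j + (n + 1) = n + I.den by omega, Nat.add_mod_right,
          Nat.add_div_right _ (by omega)]
        rw [Nat.zero_add, show c2 + 1 + n / I.den = c2 + (n / I.den + 1) by ring] at this
        exact this

theorem stF_add (i : ℕ) : ∀ (j c1 c2 : ℕ),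
    Reaches (step2 (stF prog)) ((l, j, some i), c1, c2) ((l, j, some 0), c1 + i, c2) := by
  induction i with
  | zero => intro j c1 c2; exact Relation.ReflTransGen.refl
  | succ i ih =>
    intro j c1 c2
    refine Relation.ReflTransGen.head (b := ((l, j, some i), c1 + 1, c2)) ?_ ?_
    · simp [step2, stF]
    · have := ih j (c1 + 1) c2
      rwa [show c1 + 1 + i = c1 + (i + 1) by omega] at this

theorem stF_prod (hI : prog l = some I) (c2 : ℕ) : ∀ (j c1 : ℕ),
    Reaches (step2 (stF prog)) ((l, j, some 0), c1, c2) ((l, j, some 0), c1 + c2 * I.aj j, 0) := by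
  induction c2 with
  | zero => intro j c1; rw [Nat.zero_mul]; exact Relation.ReflTransGen.refl
  | succ c2 ih =>
    intro j c1
    refine Relation.ReflTransGen.head (b := ((l, j, some (I.aj j)), c1, c2)) ?_ ?_
    · simp [step2, stF, hI]
    · refine (stF_add _ _ _ _).trans ?_
      have := ih j (c1 + I.aj j)
      rwa [show c1 + I.aj j + c2 * I.aj j = c1 + (c2 + 1) * I.aj j by ring] at this

theorem stF_respects (hden : ∀ l I, prog l = some I → 0 < I.den) :
    Respects (stepF prog) (step2 (stF prog))
      (fun c d => d = ((c.1, 0, none), c.2, 0)) := by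
  rintro ⟨l, N⟩ _ rfl
  cases hI : prog l with
  | none => simp [stepF, step2, stF, hI]
  | some I =>
    have hs : stepF prog (l, N) =
      some (if N % I.den = 0 then (I.l1, N / I.den * I.num) else (I.l2, N * I.mul)) := by
        simp [stepF, hI]
    rw [hs]
    refine ⟨_, rfl, ?_⟩
    have h1 := stF_cons hI N 0 0 (hden _ _ hI)
    rw [Nat.zero_add, Nat.zero_add] at h1
    refine Relation.TransGen.trans_right h1 ?_
    refine Relation.TransGen.head' (b := ((l, N % I.den, some (I.bj (N % I.den))), 0, N / I.den)) ?_ ?_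
    · simp [step2, stF, hI]
      norm_cast
    refine (stF_add _ _ _ _).trans ?_
    refine (stF_prod hI _ _ _).trans ?_
    refine Relation.ReflTransGen.single ?_
    by_cases h : N % I.den = 0
    · simp [step2, stF, hI, h, FInstr.lj, FInstr.aj, FInstr.bj]
      norm_cast
    · simp [step2, stF, hI, h, FInstr.lj, FInstr.aj, FInstr.bj]
      have := Nat.mod_add_div N I.den
      have h2 : N * I.mul = (N % I.den + I.den * (N / I.den)) * I.mul := by rw [this]
      norm_cast
      rw [h2]
      ring

theorem computable_haltingF (SL : Finset L)
    (hcl : ∀ l ∈ SL, ∀ I, prog l = some I → 0 < I.den ∧ I.l1 ∈ SL ∧ I.l2 ∈ SL)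
    (hden : ∀ l I, prog l = some I → 0 < I.den)
    (l0 : L) (hl0 : l0 ∈ SL)
    (f : ℕ → Bool) (hf : Computable f) (hfM : ∀ M, f (encodeTCM M) = true ↔ M.Halts)
    (E : ℕ → ℕ) (hE : Computable E) (hE0 : ∀ n, 0 < E n) :
    ∃ g : ℕ → Bool, Computable g ∧ ∀ n, g n = true ↔ (eval (stepF prog) (l0, E n)).Dom := by
  classical
  let B : ℕ := SL.sup fun l => match prog l with
    | none => 0
    | some I => I.den + I.num + I.den * I.mul
  have hB : ∀ l ∈ SL, ∀ I, prog l = some I → I.den + I.num + I.den * I.mul ≤ B := by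
    intro l hl I hI
    have := Finset.le_sup (f := fun l => match prog l with
      | none => 0
      | some I => I.den + I.num + I.den * I.mul) hl
    simp only [hI] at this
    exact this
  let S : Finset (L × ℕ × Option ℕ) :=
    SL ×ˢ (Finset.range (B + 1) ×ˢ (Finset.insertNone (Finset.range (B * B + B + 1))))
  have hS : ∀ l j o, (l, j, o) ∈ S ↔ l ∈ SL ∧ j < B + 1 ∧ ∀ i ∈ o, i < B * B + B + 1 := by
    intro l j o
    simp [S, Finset.mem_insertNone]
  have hgg := computable_halting (stF prog) S ?_ (l0, 0, none) ?_ f hf hfM E hE hE0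
  · obtain ⟨g, hg, h⟩ := hgg
    refine ⟨g, hg, fun n => ?_⟩
    rw [h]
    exact tr_eval_dom (stF_respects hden) rfl
  · rintro ⟨l, j, o⟩ hq b1 b2 r hr
    rw [hS] at hq
    obtain ⟨hl, hj, ho⟩ := hq
    match o, ho, hr with
    | none, _, hr =>
      simp only [stF, Option.map_eq_some_iff] at hr
      obtain ⟨I, hI, rfl⟩ := hr
      have hb := hB l hl I hI
      split_ifs with h1 h2
      · refine ⟨(hS _ _ _).2 ⟨hl, by omega, by simp⟩, by simp, by simp⟩
      · refine ⟨(hS _ _ _).2 ⟨hl, by omega, by simp⟩, by simp, by simp⟩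
      · refine ⟨(hS _ _ _).2 ⟨hl, by omega, ?_⟩, by simp, by simp⟩
        simp only [Option.mem_def, Option.some.injEq, forall_eq']
        unfold FInstr.bj
        split_ifs
        · omega
        · have hm : I.mul ≤ B := by
            have := Nat.le_mul_of_pos_left I.mul (hden l I hI)
            omega
          have : j * I.mul ≤ B * B := Nat.mul_le_mul (by omega) hm
          omega
    | some 0, _, hr =>
      simp only [stF, Option.map_eq_some_iff] at hr
      obtain ⟨I, hI, rfl⟩ := hr
      have hb := hB l hl I hI
      split_ifs with h1
      · refine ⟨(hS _ _ _).2 ⟨hl, by omega, ?_⟩, by simp, by simp⟩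
        simp only [Option.mem_def, Option.some.injEq, forall_eq']
        unfold FInstr.aj
        split_ifs <;> nlinarith
      · refine ⟨(hS _ _ _).2 ⟨?_, by omega, by simp⟩, by simp, by simp⟩
        unfold FInstr.lj
        split_ifs
        · exact (hcl l hl I hI).2.1
        · exact (hcl l hl I hI).2.2
    | some (i + 1), ho, hr =>
      simp only [stF, Option.some.injEq] at hr
      subst hr
      refine ⟨(hS _ _ _).2 ⟨hl, hj, ?_⟩, by simp, by simp⟩
      have := ho (i + 1) rfl
      simp only [Option.mem_def, Option.some.injEq, forall_eq']
      omega
  · exact (hS _ _ _).2 ⟨hl0, by omega, by simp⟩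

end

/-! ### Stack machines (TM2) simulated by Fractran-like machines -/

open StateTransition
open Turing.PartrecToTM2 (Γ' K' Λ')

abbrev StT := Turing.TM2.Stmt (fun _ : K' => Γ') Λ' (Option Γ')
abbrev LbT := Option (Bool × ℕ) × Option StT × Option Γ'

def prT : K' → ℕ
  | K'.main => 2
  | K'.rev => 3
  | K'.aux => 5
  | K'.stack => 7

def dgT : Γ' → ℕ
  | Γ'.consₗ => 1
  | Γ'.cons => 2
  | Γ'.bit0 => 3
  | Γ'.bit1 => 4

def undg : ℕ → Option Γ'
  | 1 => some Γ'.consₗ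
  | 2 => some Γ'.cons
  | 3 => some Γ'.bit0
  | 4 => some Γ'.bit1
  | _ => none

def stkT : List Γ' → ℕ
  | [] => 0
  | a :: l => dgT a + 5 * stkT l

theorem undg_stkT (l : List Γ') : undg (stkT l % 5) = l.head? := by
  cases l with
  | nil => rfl
  | cons a l => cases a <;> simp [stkT, dgT, Nat.add_mod, undg]

theorem stkT_tail (l : List Γ') : stkT l / 5 = stkT l.tail := by
  cases l with
  | nil => rfl
  | cons a l =>
    rw [List.tail_cons, stkT]
    cases a <;> simp only [dgT] <;> omega

def numT (S : K' → List Γ') : ℕ :=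
  2 ^ stkT (S K'.main) * 3 ^ stkT (S K'.rev) * 5 ^ stkT (S K'.aux) * 7 ^ stkT (S K'.stack)

theorem prT_prime (k : K') : (prT k).Prime := by cases k <;> norm_num [prT]

theorem prT_ne (k : K') : prT k ≠ 11 := by cases k <;> norm_num [prT]

theorem numT_local [DecidableEq K'] (S : K' → List Γ') (k : K') :
    ∃ r, ¬ prT k ∣ r ∧ ¬ 11 ∣ r ∧ ∀ l, numT (Function.update S k l) = prT k ^ stkT l * r := by
  have key : ∀ p a b c d e f : ℕ, p.Prime → Nat.Coprime p a → Nat.Coprime p b → Nat.Coprime p c →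
      ¬ p ∣ a ^ d * b ^ e * c ^ f := by
    intro p a b c d e f hp ha hb hc h
    have : Nat.Coprime p (a ^ d * b ^ e * c ^ f) :=
      ((ha.pow_right d).mul_right (hb.pow_right e)).mul_right (hc.pow_right f)
    have := this.eq_one_of_dvd h
    exact hp.one_lt.ne' this
  cases k
  · refine ⟨3 ^ stkT (S K'.rev) * 5 ^ stkT (S K'.aux) * 7 ^ stkT (S K'.stack),
      key _ _ _ _ _ _ _ (prT_prime _) ?_ ?_ ?_, key _ _ _ _ _ _ _ ?_ ?_ ?_ ?_, fun l => ?_⟩ <;>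
      try norm_num [prT]
    simp [numT]; ring
  · refine ⟨2 ^ stkT (S K'.main) * 5 ^ stkT (S K'.aux) * 7 ^ stkT (S K'.stack),
      key _ _ _ _ _ _ _ (prT_prime _) ?_ ?_ ?_, key _ _ _ _ _ _ _ ?_ ?_ ?_ ?_, fun l => ?_⟩ <;>
      try norm_num [prT]
    simp [numT]; ring
  · refine ⟨2 ^ stkT (S K'.main) * 3 ^ stkT (S K'.rev) * 7 ^ stkT (S K'.stack),
      key _ _ _ _ _ _ _ (prT_prime _) ?_ ?_ ?_, key _ _ _ _ _ _ _ ?_ ?_ ?_ ?_, fun l => ?_⟩ <;>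
      try norm_num [prT]
    simp [numT]; ring
  · refine ⟨2 ^ stkT (S K'.main) * 3 ^ stkT (S K'.rev) * 5 ^ stkT (S K'.aux),
      key _ _ _ _ _ _ _ (prT_prime _) ?_ ?_ ?_, key _ _ _ _ _ _ _ ?_ ?_ ?_ ?_, fun l => ?_⟩ <;>
      try norm_num [prT]
    simp [numT]; ring

section
variable {L : Type} {prog : L → Option (FInstr L)}

theorem stepF_loop {l l' : L} {D U c : ℕ} (h : prog l = some ⟨D, U, l, c, l'⟩) (hD : 0 < D)
    (t : ℕ) : ∀ y, ¬ D ∣ y * U ^ t →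
      Reaches₁ (stepF prog) (l, D ^ t * y) (l', y * U ^ t * c) := by
  induction t with
  | zero =>
    intro y hy
    refine Relation.TransGen.single ?_
    rw [pow_zero, mul_one] at hy
    rw [pow_zero, pow_zero, mul_one, one_mul]
    have : ¬ (y % D = 0) := fun e => hy (Nat.dvd_of_mod_eq_zero e)
    simp [stepF, h, this]
  | succ t ih =>
    intro y hy
    refine Relation.TransGen.head (b := (l, D ^ t * (y * U))) ?_ ?_
    · have e : D ^ (t + 1) * y = D * (D ^ t * y) := by ring
      have h1 : D ^ (t + 1) * y % D = 0 := by rw [e]; exact Nat.mul_mod_right _ _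
      have h2 : D ^ (t + 1) * y / D = D ^ t * y := by rw [e]; exact Nat.mul_div_cancel_left _ hD
      simp only [stepF, h, Option.map_some, h1, h2, if_true, Option.mem_def]
      rw [mul_assoc]
    · have := ih (y * U) (by rwa [mul_assoc, ← pow_succ'])
      rwa [mul_assoc y U, ← pow_succ'] at this

theorem stepF_one {l l' : L} (h : prog l = some ⟨1, 1, l', 1, l'⟩) (N : ℕ) :
    Reaches₁ (stepF prog) (l, N) (l', N) := by
  refine Relation.TransGen.single ?_
  simp [stepF, h, Nat.mod_one]

end

section
variable (trM : Λ' → StT)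

def progT : LbT → Option (FInstr LbT)
  | (_, none, _) => none
  | (none, some (.push k f q), v) =>
    some ⟨prT k, 11, (none, some (.push k f q), v), 1, (some (true, 0), some (.push k f q), v)⟩
  | (some (_, j), some (.push k f q), v) =>
    some ⟨11, prT k ^ 5, (some (true, j), some (.push k f q), v), prT k ^ dgT (f v), (none, some q, v)⟩
  | (none, some (.pop k f q), v) =>
    some ⟨prT k ^ 5, 11, (none, some (.pop k f q), v), 1, (some (false, 0), some (.pop k f q), v)⟩
  | (some (false, j), some (.pop k f q), v) =>
    some ⟨prT k, 1, (some (false, (j + 1) % 5), some (.pop k f q), v), 1,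
      (some (true, j), some (.pop k f q), v)⟩
  | (some (true, j), some (.pop k f q), v) =>
    some ⟨11, prT k, (some (true, j), some (.pop k f q), v), 1, (none, some q, f v (undg j))⟩
  | (none, some (.peek k f q), v) =>
    some ⟨prT k ^ 5, 11, (none, some (.peek k f q), v), 1, (some (false, 0), some (.peek k f q), v)⟩
  | (some (false, j), some (.peek k f q), v) =>
    some ⟨prT k, 1, (some (false, (j + 1) % 5), some (.peek k f q), v), 1,
      (some (true, j), some (.peek k f q), v)⟩
  | (some (true, j), some (.peek k f q), v) =>
    some ⟨11, prT k ^ 5, (some (true, j), some (.peek k f q), v), prT k ^ j,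
      (none, some q, f v (undg j))⟩
  | (_, some (.load a q), v) => some ⟨1, 1, (none, some q, a v), 1, (none, some q, a v)⟩
  | (_, some (.branch f q1 q2), v) =>
    some ⟨1, 1, (none, some (bif f v then q1 else q2), v), 1,
      (none, some (bif f v then q1 else q2), v)⟩
  | (_, some (.goto f), v) =>
    some ⟨1, 1, (none, some (trM (f v)), v), 1, (none, some (trM (f v)), v)⟩
  | (_, some .halt, v) => some ⟨1, 1, (none, none, v), 1, (none, none, v)⟩

theorem progT_den (l : LbT) (I : FInstr LbT) (h : progT trM l = some I) : 0 < I.den := by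
  have hp := fun k => (prT_prime k).pos
  obtain ⟨ph, q, v⟩ := l
  cases q with
  | none => simp [progT] at h
  | some q =>
    rcases ph with _ | ⟨_ | _, j⟩ <;> cases q <;>
      simp only [progT, Option.some.injEq] at h <;> subst h <;> simp [hp]

/-- Counting out the digit. -/
theorem cnt_loop {prog : LbT → Option (FInstr LbT)} {q : StT} {v : Option Γ'} {p : ℕ} (hp : 0 < p)
    (h : ∀ j, prog (some (false, j), some q, v) = some ⟨p, 1, (some (false, (j + 1) % 5), some q, v),
      1, (some (true, j), some q, v)⟩) (y : ℕ) (hy : ¬ p ∣ y) (d : ℕ) : ∀ j, j + d < 5 →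
    Reaches₁ (stepF prog) ((some (false, j), some q, v), p ^ d * y)
      ((some (true, j + d), some q, v), y) := by
  induction d with
  | zero =>
    intro j _
    refine Relation.TransGen.single ?_
    have : ¬ (y % p = 0) := fun e => hy (Nat.dvd_of_mod_eq_zero e)
    simp [stepF, h, this]
  | succ d ih =>
    intro j hj
    refine Relation.TransGen.head (b := ((some (false, j + 1), some q, v), p ^ d * y)) ?_ ?_
    · have e : p ^ (d + 1) * y = p * (p ^ d * y) := by ring
      have h1 : p ^ (d + 1) * y % p = 0 := by rw [e]; exact Nat.mul_mod_right _ _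
      have h2 : p ^ (d + 1) * y / p = p ^ d * y := by rw [e]; exact Nat.mul_div_cancel_left _ hp
      simp only [stepF, h, Option.map_some, h1, h2, if_true, Option.mem_def, mul_one]
      rw [Nat.mod_eq_of_lt (by omega)]
    · have := ih (j + 1) (by omega)
      rwa [show j + 1 + d = j + (d + 1) by omega] at this

theorem not_dvd_mul_pow {p r s t : ℕ} (hp : p.Prime) (hs : s.Prime) (hps : p ≠ s) (hr : ¬ p ∣ r) :
    ¬ p ∣ r * s ^ t := by
  intro h
  rcases (Nat.Prime.dvd_mul hp).1 h with h | h
  · exact hr h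
  · exact hps ((Nat.prime_dvd_prime_iff_eq hp hs).1 (hp.dvd_of_dvd_pow h))

theorem digit_phase {q : StT} {v : Option Γ'} {k : K'}
    (h0 : progT trM (none, some q, v) =
      some ⟨prT k ^ 5, 11, (none, some q, v), 1, (some (false, 0), some q, v)⟩)
    (h : ∀ j, progT trM (some (false, j), some q, v) =
      some ⟨prT k, 1, (some (false, (j + 1) % 5), some q, v),
      1, (some (true, j), some q, v)⟩) (r : ℕ) (hr : ¬ prT k ∣ r) (a : ℕ) :
    Reaches₁ (stepF (progT trM)) ((none, some q, v), prT k ^ a * r)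
      ((some (true, a % 5), some q, v), 11 ^ (a / 5) * r) := by
  have hp := prT_prime k
  have h11 : Nat.Prime 11 := by norm_num
  have e : prT k ^ a * r = (prT k ^ 5) ^ (a / 5) * (prT k ^ (a % 5) * r) := by
    rw [← pow_mul, ← mul_assoc, ← pow_add, Nat.div_add_mod]
  rw [e]
  have hnd : ¬ prT k ∣ r * 11 ^ (a / 5) := not_dvd_mul_pow hp h11 (prT_ne k) hr
  have h1 := stepF_loop h0 (pow_pos hp.pos 5) (a / 5) (prT k ^ (a % 5) * r) ?_
  · refine h1.trans ?_
    have h2 := cnt_loop hp.pos h (r * 11 ^ (a / 5)) hnd (a % 5) 0 (by omega)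
    rw [Nat.zero_add] at h2
    rw [mul_one, mul_assoc, mul_comm (11 ^ (a / 5))]
    exact h2
  · intro hd
    apply hnd
    have h5 : prT k ^ (a % 5) * prT k ∣ prT k ^ (a % 5) * (r * 11 ^ (a / 5)) := by
      rw [← pow_succ, ← mul_assoc]
      exact (pow_dvd_pow _ (by omega)).trans hd
    exact Nat.dvd_of_mul_dvd_mul_left (pow_pos hp.pos _) h5

def cfgT (c : Turing.TM2.Cfg (fun _ : K' => Γ') Λ' (Option Γ')) : LbT × ℕ :=
  ((none, c.l.map trM, c.var), numT c.stk)

theorem stepAux_reaches [DecidableEq K'] (q : StT) : ∀ (v : Option Γ') (S : K' → List Γ'),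
    Reaches₁ (stepF (progT trM)) ((none, some q, v), numT S)
      (cfgT trM (Turing.TM2.stepAux q v S)) := by
  have h11 : Nat.Prime 11 := by norm_num
  induction q with
  | push k f q ih =>
    intro v S
    refine Relation.TransGen.trans ?_ (ih v _)
    obtain ⟨r, hr, hr', hN⟩ := numT_local S k
    have hp := prT_prime k
    have e := hN (S k)
    rw [Function.update_eq_self] at e
    rw [e, hN]
    have h1 := stepF_loop (prog := progT trM) (l := (none, some (.push k f q), v)) rfl hp.pos
      (stkT (S k)) r (not_dvd_mul_pow hp h11 (prT_ne k) hr)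
    refine h1.trans ?_
    have h2 := stepF_loop (prog := progT trM) (l := (some (true, 0), some (.push k f q), v)) rfl
      (by norm_num) (stkT (S k)) r ?_
    · have e2 : r * (prT k ^ 5) ^ stkT (S k) * prT k ^ dgT (f v) =
          prT k ^ stkT (f v :: S k) * r := by
        rw [stkT, pow_add, ← pow_mul]
        ring
      rw [mul_one, mul_comm r, ← e2]
      exact h2
    · rw [← pow_mul]
      exact not_dvd_mul_pow h11 hp (prT_ne k).symm hr'
  | peek k f q ih =>
    intro v S
    refine Relation.TransGen.trans ?_ (ih _ _)
    obtain ⟨r, hr, hr', hN⟩ := numT_local S k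
    have hp := prT_prime k
    have e := hN (S k)
    rw [Function.update_eq_self] at e
    rw [e]
    refine (digit_phase trM (q := .peek k f q) rfl (fun _ => rfl) r hr (stkT (S k))).trans ?_
    have h2 := stepF_loop (prog := progT trM)
      (l := (some (true, stkT (S k) % 5), some (.peek k f q), v)) rfl
      (by norm_num) (stkT (S k) / 5) r ?_
    · rw [undg_stkT, mul_assoc, ← pow_mul, ← pow_add, Nat.div_add_mod, mul_comm r] at h2
      exact h2
    · rw [← pow_mul]
      exact not_dvd_mul_pow h11 hp (prT_ne k).symm hr'
  | pop k f q ih =>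
    intro v S
    refine Relation.TransGen.trans ?_ (ih _ _)
    obtain ⟨r, hr, hr', hN⟩ := numT_local S k
    have hp := prT_prime k
    have e := hN (S k)
    rw [Function.update_eq_self] at e
    rw [e, hN]
    refine (digit_phase trM (q := .pop k f q) rfl (fun _ => rfl) r hr (stkT (S k))).trans ?_
    have h2 := stepF_loop (prog := progT trM)
      (l := (some (true, stkT (S k) % 5), some (.pop k f q), v)) rfl
      (by norm_num) (stkT (S k) / 5) r ?_
    · rw [undg_stkT, stkT_tail, mul_one, mul_comm r] at h2
      rw [← stkT_tail] at h2 ⊢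
      exact h2
    · exact not_dvd_mul_pow h11 hp (prT_ne k).symm hr'
  | load a q ih =>
    intro v S
    exact Relation.TransGen.trans (stepF_one rfl _) (ih _ _)
  | branch f q1 q2 ih1 ih2 =>
    intro v S
    refine Relation.TransGen.trans (stepF_one rfl _) ?_
    rw [Turing.TM2.stepAux]
    cases f v
    · exact ih2 _ _
    · exact ih1 _ _
  | goto f =>
    intro v S
    exact stepF_one rfl _
  | halt =>
    intro v S
    exact stepF_one rfl _

theorem progT_respects [DecidableEq K'] :
    Respects (Turing.TM2.step trM) (stepF (progT trM)) (fun c d => d = cfgT trM c) := by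
  rintro ⟨l, v, S⟩ _ rfl
  cases l with
  | none => rfl
  | some l => exact ⟨_, rfl, stepAux_reaches trM _ _ _⟩

def suppT (SΛ : Finset Λ') : Finset LbT :=
  Finset.insertNone (Finset.univ ×ˢ Finset.range 5) ×ˢ (Turing.TM2.stmts trM SΛ ×ˢ Finset.univ)

theorem suppT_closed (SΛ : Finset Λ') (hS : ∀ q ∈ SΛ, Turing.TM2.SupportsStmt SΛ (trM q))
    (l : LbT) (hl : l ∈ suppT trM SΛ) (I : FInstr LbT) (h : progT trM l = some I) :
    I.l1 ∈ suppT trM SΛ ∧ I.l2 ∈ suppT trM SΛ := by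
  have hm : ∀ ph q v, (ph, q, v) ∈ suppT trM SΛ ↔
      (∀ x ∈ ph, x.2 < 5) ∧ q ∈ Turing.TM2.stmts trM SΛ := by
    intro ph q v
    simp [suppT, Finset.mem_insertNone]
  have hnone : none ∈ Turing.TM2.stmts trM SΛ := by
    simp [Turing.TM2.stmts]
  have hsub : ∀ q q' : StT, some q ∈ Turing.TM2.stmts trM SΛ → q' ∈ Turing.TM2.stmts₁ q →
      some q' ∈ Turing.TM2.stmts trM SΛ := fun q q' h h' => Turing.TM2.stmts_trans h' h
  have hsupp : ∀ q : StT, some q ∈ Turing.TM2.stmts trM SΛ → Turing.TM2.SupportsStmt SΛ q := by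
    intro q hq
    simp only [Turing.TM2.stmts, Finset.some_mem_insertNone, Finset.mem_biUnion] at hq
    obtain ⟨a, ha, hq⟩ := hq
    exact Turing.TM2.stmts₁_supportsStmt_mono hq (hS a ha)
  have htr : ∀ a ∈ SΛ, some (trM a) ∈ Turing.TM2.stmts trM SΛ := by
    intro a ha
    simp only [Turing.TM2.stmts, Finset.some_mem_insertNone, Finset.mem_biUnion]
    exact ⟨a, ha, Turing.TM2.stmts₁_self⟩
  obtain ⟨ph, q, v⟩ := l
  rw [hm] at hl
  obtain ⟨hph, hq⟩ := hl
  have hself : ∀ q : StT, q ∈ Turing.TM2.stmts₁ q := fun _ => Turing.TM2.stmts₁_self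
  cases q with
  | none => simp [progT] at h
  | some q =>
    have hs := hsupp q hq
    have hmod : ∀ j : ℕ, (j + 1) % 5 < 5 := fun j => Nat.mod_lt _ (by norm_num)
    rcases ph with _ | ⟨_ | _, j⟩ <;> cases q with
    | push k f q =>
      have := hsub _ q hq (by simp [Turing.TM2.stmts₁, hself])
      simp only [progT, Option.some.injEq] at h
      subst h
      simp_all
    | peek k f q =>
      have := hsub _ q hq (by simp [Turing.TM2.stmts₁, hself])
      simp only [progT, Option.some.injEq] at h
      subst h
      simp_all
    | pop k f q =>
      have := hsub _ q hq (by simp [Turing.TM2.stmts₁, hself])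
      simp only [progT, Option.some.injEq] at h
      subst h
      simp_all
    | load a q =>
      have := hsub _ q hq (by simp [Turing.TM2.stmts₁, hself])
      simp only [progT, Option.some.injEq] at h
      subst h
      simp_all
    | branch f q1 q2 =>
      have h1 := hsub _ q1 hq (by simp [Turing.TM2.stmts₁, hself])
      have h2 := hsub _ q2 hq (by simp [Turing.TM2.stmts₁, hself])
      simp only [progT, Option.some.injEq] at h
      subst h
      cases f v <;> simp_all
    | goto f =>
      have := htr _ (hs v)
      simp only [progT, Option.some.injEq] at h
      subst h
      simp_all
    | halt =>
      simp only [progT, Option.some.injEq] at h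
      subst h
      simp_all

end

/-! ### Conclusion -/

open StateTransition

def EK : ℕ → ℕ
  | 0 => 2 ^ 14
  | k + 1 => 8 * (EK k * EK k * EK k * EK k * EK k)

theorem EK_computable : Computable EK := by
  have h : Primrec (fun n : ℕ => (Nat.rec (2 ^ 14) (fun _ x => 8 * (x * x * x * x * x)) n : ℕ)) := by
    refine Primrec.nat_rec₁ _ ?_
    have hx : Primrec₂ fun (_ x : ℕ) => x := Primrec.snd
    have h2 := Primrec.nat_mul.comp₂ hx hx
    have h3 := Primrec.nat_mul.comp₂ h2 hx
    have h4 := Primrec.nat_mul.comp₂ h3 hx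
    have h5 := Primrec.nat_mul.comp₂ h4 hx
    exact Primrec.nat_mul.comp₂ (Primrec₂.const 8) h5
  refine (h.of_eq ?_).to_comp
  intro n
  induction n with
  | zero => rfl
  | succ n ih => rw [EK, ← ih]

theorem EK_pos (n : ℕ) : 0 < EK n := by
  induction n with
  | zero => norm_num [EK]
  | succ n ih => rw [EK]; positivity

def posT : ℕ → PosNum
  | 0 => PosNum.one
  | k + 1 => PosNum.bit0 (posT k)

theorem posT_val (k : ℕ) : ((posT k : PosNum) : ℕ) = 2 ^ k := by
  induction k with
  | zero => rfl
  | succ k ih =>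
    rw [posT, PosNum.cast_bit0, ih]
    ring

theorem EK_eq (k : ℕ) : EK k = 2 ^ stkT (Turing.PartrecToTM2.trList [2 ^ k]) := by
  have h1 : ((2 ^ k : ℕ) : Num) = Num.pos (posT k) := by
    rw [← posT_val]
    exact Num.of_to_nat (Num.pos (posT k))
  rw [Turing.PartrecToTM2.trList, Turing.PartrecToTM2.trNat, h1, Turing.PartrecToTM2.trNum,
    Turing.PartrecToTM2.trList]
  clear h1
  induction k with
  | zero => rfl
  | succ k ih =>
    rw [EK, posT, Turing.PartrecToTM2.trPosNum, List.cons_append, stkT, ih, dgT, pow_add, pow_mul']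
    ring

theorem init_numT (l : List Turing.PartrecToTM2.Γ') :
    numT (Turing.PartrecToTM2.K'.elim l [] [] []) = 2 ^ stkT l := by
  simp [numT, Turing.PartrecToTM2.K'.elim, stkT]

def decF (m : ℕ) : Part ℕ :=
  (Nat.rfind fun k => Part.some (decide (2 ^ k = m))).bind fun k =>
    Nat.Partrec.Code.eval (Denumerable.ofNat Nat.Partrec.Code k) 0

theorem decF_partrec : Partrec decF := by
  have hpow : Primrec fun k : ℕ => (2 : ℕ) ^ k := by
    refine (Primrec.nat_rec₁ (f := fun _ x => 2 * x) 1
      (Primrec.nat_mul.comp₂ (Primrec₂.const 2) Primrec.snd)).of_eq ?_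
    intro n
    induction n with
    | zero => rfl
    | succ n ih => rw [pow_succ, ← ih, mul_comm]
  unfold decF
  refine Partrec.bind (Partrec.rfind ?_) ?_
  · refine Computable.partrec ?_
    have : PrimrecPred fun x : ℕ × ℕ => 2 ^ x.2 = x.1 :=
      Primrec.eq.comp (hpow.comp Primrec.snd) Primrec.fst
    refine (this.decide).to_comp.of_eq ?_
    intro n
    congr
  · exact Nat.Partrec.Code.eval_part.comp
      ((Computable.ofNat _).comp Computable.snd) (Computable.const 0)

theorem decF_dom (k : ℕ) : (decF (2 ^ k)).Dom ↔
    (Nat.Partrec.Code.eval (Denumerable.ofNat Nat.Partrec.Code k) 0).Dom := by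
  have : (Nat.rfind fun k' => Part.some (decide (2 ^ k' = 2 ^ k))) = Part.some k := by
    refine Part.eq_some_iff.2 (Nat.mem_rfind.2 ?_)
    constructor
    · simp
    · intro m hm
      simp
      omega
  rw [decF, this, Part.bind_some]

theorem final_undecidable (f : ℕ → Bool) (hf : Computable f)
    (hfM : ∀ M, f (encodeTCM M) = true ↔ M.Halts) : False := by
  obtain ⟨c, hc⟩ := Turing.ToPartrec.Code.exists_code (Nat.Partrec'.part_iff₁.2 decF_partrec)
  have hsup := Turing.PartrecToTM2.tr_supports c Turing.PartrecToTM2.Cont'.halt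
  have hmem : ((none, some (Turing.PartrecToTM2.tr
      (Turing.PartrecToTM2.trNormal c Turing.PartrecToTM2.Cont'.halt)), none) : LbT) ∈
      suppT Turing.PartrecToTM2.tr
        (Turing.PartrecToTM2.codeSupp c Turing.PartrecToTM2.Cont'.halt) := by
    refine Finset.mem_product.2 ⟨Finset.none_mem_insertNone, Finset.mem_product.2
      ⟨Finset.some_mem_insertNone.2 (Finset.mem_biUnion.2 ⟨_, hsup.1, ?_⟩), Finset.mem_univ _⟩⟩
    exact Turing.TM2.stmts₁_self
  obtain ⟨g, hg, h⟩ := computable_haltingF (prog := progT Turing.PartrecToTM2.tr)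
    (suppT Turing.PartrecToTM2.tr
      (Turing.PartrecToTM2.codeSupp c Turing.PartrecToTM2.Cont'.halt))
    (fun l hl I hI => ⟨progT_den _ l I hI, suppT_closed _ _ hsup.2 l hl I hI⟩)
    (progT_den _)
    (none, some (Turing.PartrecToTM2.tr
      (Turing.PartrecToTM2.trNormal c Turing.PartrecToTM2.Cont'.halt)), none) hmem
    f hf hfM EK EK_computable EK_pos
  · have key : ∀ k, g k = true ↔
        (Nat.Partrec.Code.eval (Denumerable.ofNat Nat.Partrec.Code k) 0).Dom := by
      intro k
      rw [h, ← decF_dom]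
      have h1 := Turing.PartrecToTM2.tr_eval c [2 ^ k]
      have h2 := hc ⟨[2 ^ k], rfl⟩
      have h3 := tr_eval_dom (progT_respects Turing.PartrecToTM2.tr)
        (a₁ := Turing.PartrecToTM2.init c [2 ^ k]) rfl
      rw [h1] at h3
      have e : cfgT Turing.PartrecToTM2.tr (Turing.PartrecToTM2.init c [2 ^ k]) =
        ((none, some (Turing.PartrecToTM2.tr
          (Turing.PartrecToTM2.trNormal c Turing.PartrecToTM2.Cont'.halt)), none), EK k) := by
        rw [EK_eq, ← init_numT]
        rfl
      rw [e] at h3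
      refine Iff.trans h3 ?_
      change (Turing.ToPartrec.Code.eval c [2 ^ k]).Dom ↔ _
      rw [show c.eval [2 ^ k] = _ from h2]
      exact Iff.rfl
    refine ComputablePred.halting_problem 0 (ComputablePred.computable_iff.2
      ⟨fun c => g (Encodable.encode c), hg.comp Computable.encode, ?_⟩)
    funext c
    refine propext ?_
    rw [key, Denumerable.ofNat_encode]

/-- 3CMs are effectively encodable, and chase termination (for each
variant and each quantifier) is undecidable within the class `C = {R_M}`. -/
theorem stmt_10 :
    Function.Injective encodeTCM ∧
    ∀ (X : ChaseVariant) (Q : CTQuant),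
      ¬ ∃ f : ℕ → Bool, Computable f ∧
        ∀ M : TCM, (f (encodeTCM M) = true ↔ CT X Q (RM M)) := by
  refine ⟨encodeTCM_injective, ?_⟩
  rintro X Q ⟨f, hf, h⟩
  exact final_undecidable f hf fun M => (h M).trans (CT_iff_halts M X Q)

end
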